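/- arXiv:1209.5409 — 3 statements merged into one kernel-verified Lean document; each statement's English description precedes it below -/
import Mathlib

section
/- Let μ ⊆ ν ⊆ π be Young diagrams. Let δ₁ and δ₂ be dual equivalent standard Young tableaux of shape ν/μ, and let ε₁ and ε₂ be dual equivalent standard Young tableaux of shape π/ν. For k = 1, 2 let (ε'_k, δ'_k) be the shuffle of (δ_k, ε_k). Then ε'_1 and ε'_2 have the same shape and are dual equivalent, and δ'_1 and δ'_2 have the same shape and are dual equivalent. -/
/-- `ν` is obtained from `μ` by adding one box. -/
def AddBox (μ ν : YoungDiagram) : Prop := μ ≤ ν ∧ ν.card = μ.card + 1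

/-- Two cells of `ℕ × ℕ` are adjacent: `|a−a'| + |b−b'| = 1`. -/
def CellAdj (c c' : ℕ × ℕ) : Prop :=
  |(c.1 : ℤ) - (c'.1 : ℤ)| + |(c.2 : ℤ) - (c'.2 : ℤ)| = 1

/-- A growth diagram on the rectangle `[a,b] × [c,e]`: a map `γ` on the rectangle
(normalized to `⊥` off it) into Young diagrams with `γ i (j+1)` and `γ (i−1) j`
obtained from `γ i j` by adding one box, and such that whenever the two cells of
`γ (i−1) (j+1) \ γ i j` are nonadjacent, `γ i (j+1) ≠ γ (i−1) j`. -/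
structure GrowthDiagram (a b c e : ℤ) where
  γ : ℤ → ℤ → YoungDiagram
  junk : ∀ i j : ℤ, ¬ (a ≤ i ∧ i ≤ b ∧ c ≤ j ∧ j ≤ e) → γ i j = ⊥
  grow_right : ∀ i j : ℤ, a ≤ i → i ≤ b → c ≤ j → j + 1 ≤ e →
    AddBox (γ i j) (γ i (j + 1))
  grow_up : ∀ i j : ℤ, a ≤ i - 1 → i ≤ b → c ≤ j → j ≤ e →
    AddBox (γ i j) (γ (i - 1) j)
  nonadj : ∀ i j : ℤ, a ≤ i - 1 → i ≤ b → c ≤ j → j + 1 ≤ e →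
    (∃ c₁ ∈ (γ (i - 1) (j + 1)).cells \ (γ i j).cells,
      ∃ c₂ ∈ (γ (i - 1) (j + 1)).cells \ (γ i j).cells, c₁ ≠ c₂ ∧ ¬ CellAdj c₁ c₂) →
    γ i (j + 1) ≠ γ (i - 1) j

/-- A standard Young tableau of shape `ν/μ`, encoded as a chain
`μ = T 0 ⊆ T 1 ⊆ ⋯ ⊆ T (|ν|−|μ|) = ν` adding one box at each step. -/
def IsSYTChain (μ ν : YoungDiagram) (T : ℕ → YoungDiagram) : Prop :=
  μ ≤ ν ∧ T 0 = μ ∧ T (ν.card - μ.card) = ν ∧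
    ∀ t : ℕ, t < ν.card - μ.card → AddBox (T t) (T (t + 1))

/-- `IsShuffle m q p δ ε ε' δ'`: the shuffle of the pair `(δ, ε)` — where `δ` is a
standard tableau of shape `ν/μ` and `ε` one of shape `π/ν`, with `m = |μ|`,
`q = |ν|`, `p = |π|` — equals `(ε', δ')`.  It is witnessed by a growth diagram on
`[−(p−q), 0] × [m, q]` with right column `δ`, top row `ε`, bottom row `ε'` read
along the left of the column `m`, and left column `δ'`. -/
def IsShuffle (m q p : ℕ) (δ ε ε' δ' : ℕ → YoungDiagram) : Prop :=
  ∃ g : GrowthDiagram (-((p - q : ℕ) : ℤ)) 0 (m : ℤ) (q : ℤ),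
    (∀ t : ℕ, t ≤ q - m → g.γ 0 ((m : ℤ) + t) = δ t) ∧
    (∀ t : ℕ, t ≤ p - q → g.γ (-(t : ℤ)) (q : ℤ) = ε t) ∧
    (∀ t : ℕ, t ≤ p - q → g.γ (-(t : ℤ)) (m : ℤ) = ε' t) ∧
    (∀ t : ℕ, t ≤ q - m → g.γ (-((p - q : ℕ) : ℤ)) ((m : ℤ) + t) = δ' t)


/-- Dual equivalence of two standard tableaux `δ₁, δ₂` of the same shape `ν/μ`:
for every `π ⊇ ν` and every standard tableau `ε` of shape `π/ν`, the first
components of the shuffles of `(δ₁, ε)` and of `(δ₂, ε)` agree. -/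
def DualEquiv (μ ν : YoungDiagram) (δ₁ δ₂ : ℕ → YoungDiagram) : Prop :=
  IsSYTChain μ ν δ₁ ∧ IsSYTChain μ ν δ₂ ∧
  ∀ (π : YoungDiagram) (ε ε₁' δ₁' ε₂' δ₂' : ℕ → YoungDiagram),
    IsSYTChain ν π ε →
    IsShuffle μ.card ν.card π.card δ₁ ε ε₁' δ₁' →
    IsShuffle μ.card ν.card π.card δ₂ ε ε₂' δ₂' →
    ∀ t : ℕ, t ≤ π.card - ν.card → ε₁' t = ε₂' t

namespace ContentWord

/-! ### Switching words of contents

A standard tableau is recorded by the word of contents of its successive boxes. -/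

/-- The local rule of growth diagrams, in terms of contents. -/
def sw (a b : ℤ) : ℤ × ℤ := if |a - b| = 1 then (a, b) else (b, a)

lemma sw_of_adj {a b : ℤ} (h : |a - b| = 1) : sw a b = (a, b) := if_pos h

lemma sw_of_not_adj {a b : ℤ} (h : |a - b| ≠ 1) : sw a b = (b, a) := if_neg h

lemma sw_sw (a b : ℤ) : sw (sw a b).1 (sw a b).2 = (a, b) := by
  by_cases h : |a - b| = 1
  · simp [sw, h]
  · have h' : ¬ |b - a| = 1 := by rwa [abs_sub_comm]
    simp [sw, h, h']

lemma sw_comm (a b : ℤ) : sw b a = ((sw a b).2, (sw a b).1) := by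
  by_cases h : |a - b| = 1
  · simp [sw, h, abs_sub_comm b a]
  · simp [sw, h, abs_sub_comm b a]

/-- Slide the letter `d` leftwards through the word `w`. -/
def slide : List ℤ → ℤ → ℤ × List ℤ
  | [], d => (d, [])
  | a :: u, d => ((sw a (slide u d).1).1, (sw a (slide u d).1).2 :: (slide u d).2)

/-- Slide the word `e` leftwards through the word `w`, letter by letter. -/
def shuf : List ℤ → List ℤ → List ℤ × List ℤ
  | w, [] => ([], w)
  | w, d :: e => ((slide w d).1 :: (shuf (slide w d).2 e).1, (shuf (slide w d).2 e).2)

lemma shuf_append_right (w e f : List ℤ) :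
    shuf w (e ++ f) = ((shuf w e).1 ++ (shuf (shuf w e).2 f).1, (shuf (shuf w e).2 f).2) := by
  induction e generalizing w with
  | nil => simp [shuf]
  | cons d e ih => simp [shuf, ih]

lemma slide_append (u w : List ℤ) (d : ℤ) :
    slide (u ++ w) d =
      ((slide u (slide w d).1).1, (slide u (slide w d).1).2 ++ (slide w d).2) := by
  induction u with
  | nil => simp [slide]
  | cons a u ih => simp [slide, ih]

lemma shuf_append_left (u w e : List ℤ) :
    shuf (u ++ w) e = ((shuf u (shuf w e).1).1, (shuf u (shuf w e).1).2 ++ (shuf w e).2) := by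
  induction e generalizing u w with
  | nil => simp [shuf]
  | cons d e ih => simp [shuf, ih, slide_append]

lemma shuf_slide (w : List ℤ) (d : ℤ) : shuf [(slide w d).1] (slide w d).2 = (w, [d]) := by
  induction w with
  | nil => rfl
  | cons a u ih => simp [slide, shuf, sw_sw, ih]

/-- Shuffling is an involution. -/
lemma shuf_shuf (w e : List ℤ) : shuf (shuf w e).1 (shuf w e).2 = (w, e) := by
  induction e generalizing w with
  | nil =>
    have h (l : List ℤ) : shuf [] l = (l, []) := by
      induction l with
      | nil => rfl
      | cons a l ih => simp [shuf, slide, ih]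
    simp [shuf, h]
  | cons d e ih =>
    have h := shuf_append_left [(slide w d).1] (shuf (slide w d).2 e).1 (shuf (slide w d).2 e).2
    rw [ih, shuf_slide] at h
    simpa [shuf] using h

lemma shuf_singleton_reverse (w : List ℤ) (d : ℤ) :
    shuf [d] w.reverse = ((slide w d).2.reverse, [(slide w d).1]) := by
  induction w with
  | nil => rfl
  | cons a u ih =>
    rw [List.reverse_cons, shuf_append_right, ih]
    simp [shuf, slide, sw_comm a]

/-- Shuffling commutes with the reversal of words. -/
lemma shuf_reverse (w e : List ℤ) :
    shuf e.reverse w.reverse = ((shuf w e).2.reverse, (shuf w e).1.reverse) := by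
  induction e generalizing w with
  | nil =>
    have := shuf_shuf w.reverse []
    simpa [shuf] using this
  | cons d e ih =>
    rw [List.reverse_cons, shuf_append_left, shuf_singleton_reverse, ih]
    simp [shuf]

/-! ### Commutations of nonadjacent letters -/

/-- Exchange of two consecutive letters that are not adjacent integers. -/
inductive CommStep : List ℤ → List ℤ → Prop
  | swap (a b : ℤ) (v : List ℤ) : |a - b| ≠ 1 → CommStep (a :: b :: v) (b :: a :: v)
  | cons (a : ℤ) {u v : List ℤ} : CommStep u v → CommStep (a :: u) (a :: v)

/-- Equivalence of words under commutations of letters that are not adjacent integers. -/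
abbrev Comm : List ℤ → List ℤ → Prop := Relation.ReflTransGen CommStep

lemma Comm.cons (a : ℤ) {u v : List ℤ} (h : Comm u v) : Comm (a :: u) (a :: v) :=
  h.lift (a :: ·) fun _ _ => CommStep.cons a

lemma Comm.append_left (w : List ℤ) {u v : List ℤ} (h : Comm u v) : Comm (w ++ u) (w ++ v) := by
  induction w with
  | nil => exact h
  | cons a w ih => exact ih.cons a

lemma CommStep.append_right {u v : List ℤ} (h : CommStep u v) (w : List ℤ) :
    CommStep (u ++ w) (v ++ w) := by
  induction h with
  | swap a b v h => exact .swap a b _ h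
  | cons a _ ih => exact ih.cons a

lemma Comm.append_right {u v : List ℤ} (h : Comm u v) (w : List ℤ) : Comm (u ++ w) (v ++ w) :=
  h.lift (· ++ w) fun _ _ h => h.append_right w

lemma CommStep.reverse {u v : List ℤ} (h : CommStep u v) : Comm u.reverse v.reverse := by
  induction h with
  | swap a b v h =>
    have := (CommStep.swap b a [] (by rwa [abs_sub_comm]))
    simpa using Comm.append_left v.reverse (.single this)
  | cons a _ ih => simpa using ih.append_right [a]

lemma Comm.reverse {u v : List ℤ} (h : Comm u v) : Comm u.reverse v.reverse := by
  induction h with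
  | refl => exact .refl
  | tail _ h ih => exact ih.trans h.reverse

lemma comm_slide (w : List ℤ) (d : ℤ) : Comm (w ++ [d]) ((slide w d).1 :: (slide w d).2) := by
  induction w with
  | nil => exact .refl
  | cons a u ih =>
    refine (ih.cons a).trans ?_
    by_cases h : |a - (slide u d).1| = 1
    · simp only [slide, sw_of_adj h]
      exact .refl
    · simp only [slide, sw_of_not_adj h]
      exact .single (.swap _ _ _ h)

/-- A word none of whose commutation equivalents has a factor `a a` or `a b a`. -/
def Reduced (w : List ℤ) : Prop :=
  ∀ w', Comm w w' → ∀ (u : List ℤ) (a b : ℤ) (v : List ℤ),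
    w' ≠ u ++ a :: a :: v ∧ w' ≠ u ++ a :: b :: a :: v

lemma Reduced.comm {w w' : List ℤ} (h : Reduced w) (hw : Comm w w') : Reduced w' :=
  fun _ h' => h _ (hw.trans h')

lemma Reduced.of_append_right {u v : List ℤ} (h : Reduced (u ++ v)) : Reduced v := by
  intro w' hw' x a b y
  have := h _ (hw'.append_left u) (u ++ x) a b y
  simpa using this

lemma Reduced.of_append_left {u v : List ℤ} (h : Reduced (u ++ v)) : Reduced u := by
  intro w' hw' x a b y
  have := h _ (hw'.append_right v) x a b (y ++ v)
  constructor
  · rintro rfl; simp at this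
  · rintro rfl; simp at this

lemma Reduced.reverse {w : List ℤ} (h : Reduced w) : Reduced w.reverse := by
  intro w' hw' x a b y
  have hr := hw'.reverse
  rw [List.reverse_reverse] at hr
  have := h _ hr y.reverse a b x.reverse
  constructor
  · rintro rfl; simp at this
  · rintro rfl; simp at this

/-! ### Elementary dual equivalence -/

/-- `c` lies strictly between `a` and `b`. -/
def Between (c a b : ℤ) : Prop := (a < c ∧ c < b) ∨ (b < c ∧ c < a)

/-- An elementary dual equivalence: exchange of two letters one of whose outer neighbours
lies strictly between them. -/
inductive Elem : List ℤ → List ℤ → Prop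
  | front (a b c : ℤ) (v : List ℤ) : Between c a b → Elem (a :: b :: c :: v) (b :: a :: c :: v)
  | back (a b c : ℤ) (v : List ℤ) : Between a b c → Elem (a :: b :: c :: v) (a :: c :: b :: v)
  | cons (a : ℤ) {u v : List ℤ} : Elem u v → Elem (a :: u) (a :: v)

/-- The equivalence relation generated by elementary dual equivalences. -/
abbrev ElemEquiv : List ℤ → List ℤ → Prop := Relation.ReflTransGen Elem

lemma Between.not_adj {a b c : ℤ} (h : Between c a b) : |a - b| ≠ 1 := by
  unfold Between at h
  grind

lemma Elem.commStep {u v : List ℤ} (h : Elem u v) : CommStep u v := by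
  induction h with
  | front a b c v h => exact .swap _ _ _ h.not_adj
  | back a b c v h => exact .cons _ (.swap _ _ _ h.not_adj)
  | cons a _ ih => exact .cons _ ih

lemma ElemEquiv.comm {u v : List ℤ} (h : ElemEquiv u v) : Comm u v :=
  Relation.ReflTransGen.mono (fun _ _ => Elem.commStep) _ _ h

lemma ElemEquiv.cons (a : ℤ) {u v : List ℤ} (h : ElemEquiv u v) :
    ElemEquiv (a :: u) (a :: v) :=
  h.lift (a :: ·) fun _ _ => Elem.cons a

lemma Elem.append_left (w : List ℤ) {u v : List ℤ} (h : Elem u v) : Elem (w ++ u) (w ++ v) := by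
  induction w with
  | nil => exact h
  | cons a w ih => exact ih.cons a

lemma Elem.append_right {u v : List ℤ} (h : Elem u v) (w : List ℤ) : Elem (u ++ w) (v ++ w) := by
  induction h with
  | front a b c v h => exact .front a b c _ h
  | back a b c v h => exact .back a b c _ h
  | cons a _ ih => exact ih.cons a

lemma Elem.reverse {u v : List ℤ} (h : Elem u v) : Elem u.reverse v.reverse := by
  induction h with
  | front a b c v h =>
    simpa using (Elem.back c b a [] h.symm).append_left v.reverse
  | back a b c v h =>
    simpa using (Elem.front c b a [] h.symm).append_left v.reverse
  | cons a _ ih => simpa using ih.append_right [a]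

lemma ElemEquiv.reverse {u v : List ℤ} (h : ElemEquiv u v) : ElemEquiv u.reverse v.reverse :=
  h.lift List.reverse fun _ _ => Elem.reverse

lemma Reduced.four_letters {a b c d : ℤ} (h : Reduced [a, b, c, d]) :
    a ≠ b ∧ b ≠ c ∧ a ≠ c ∧ c ≠ d ∧ b ≠ d ∧ (a = d → |a - b| = 1 ∧ |c - a| = 1) := by
  refine ⟨?_, ?_, ?_, ?_, ?_, ?_⟩
  · rintro rfl
    exact (h _ .refl [] a a [c, d]).1 rfl
  · rintro rfl
    exact (h _ .refl [a] b b [d]).1 rfl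
  · rintro rfl
    exact (h _ .refl [] a b [d]).2 rfl
  · rintro rfl
    exact (h _ .refl [a, b] c c []).1 rfl
  · rintro rfl
    exact (h _ .refl [a] b c []).2 rfl
  · rintro rfl
    constructor
    · by_contra hab
      exact (h _ (.single (.swap _ _ _ hab)) [b] a c []).2 rfl
    · by_contra hca
      exact (h _ (.single (.cons _ (.cons _ (.swap _ _ _ hca)))) [] a b [c]).2 rfl

lemma slide_front {a b c d : ℤ} (h : Reduced [a, b, c, d]) (hc : Between c a b) :
    (slide [a, b, c] d).1 = (slide [b, a, c] d).1 ∧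
      ∀ v, Elem ((slide [a, b, c] d).2 ++ v) ((slide [b, a, c] d).2 ++ v) := by
  obtain ⟨hab, hbc, hac, hcd, hbd, had⟩ := h.four_letters
  have nab : ¬ |a - b| = 1 := hc.not_adj
  have nba : ¬ |b - a| = 1 := by rwa [abs_sub_comm]
  unfold Between at hc
  by_cases ncd : |c - d| = 1 <;>
  by_cases nbc : |b - c| = 1 <;>
  by_cases nac : |a - c| = 1 <;>
  by_cases nbd : |b - d| = 1 <;>
  by_cases nad : |a - d| = 1 <;>
    simp only [slide, sw, nab, nba, ncd, nbc, nac, nbd, nad, if_true, if_false, List.cons_append,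
      List.nil_append] <;>
    first
    | exfalso; grind
    | refine ⟨?_, fun v => .front _ _ _ v ?_⟩ <;> [skip; unfold Between] <;> grind

lemma slide_back {a b c d : ℤ} (h : Reduced [a, b, c, d]) (hc : Between a b c) :
    (slide [a, b, c] d).1 = (slide [a, c, b] d).1 ∧
      ∀ v, Elem ((slide [a, b, c] d).2 ++ v) ((slide [a, c, b] d).2 ++ v) := by
  obtain ⟨hab, hbc, hac, hcd, hbd, had⟩ := h.four_letters
  have nbc : ¬ |b - c| = 1 := hc.not_adj
  have ncb : ¬ |c - b| = 1 := by rwa [abs_sub_comm]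
  unfold Between at hc
  by_cases ncd : |c - d| = 1 <;>
  by_cases nab : |a - b| = 1 <;>
  by_cases nac : |a - c| = 1 <;>
  by_cases nbd : |b - d| = 1 <;>
  by_cases nad : |a - d| = 1 <;>
    simp only [slide, sw, nbc, ncb, ncd, nab, nac, nbd, nad, if_true, if_false, List.cons_append,
      List.nil_append] <;>
    first
    | exfalso; grind
    | refine ⟨?_, fun v => .front _ _ _ v ?_⟩ <;> [skip; unfold Between] <;> grind
    | refine ⟨?_, fun v => .back _ _ _ v ?_⟩ <;> [skip; unfold Between] <;> grind

lemma Elem.slide {w w' : List ℤ} (h : Elem w w') (d : ℤ) (hw : Reduced (w ++ [d])) :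
    (slide w d).1 = (slide w' d).1 ∧ Elem (slide w d).2 (slide w' d).2 := by
  have key (a b c : ℤ) (v : List ℤ) (hw : Reduced ((a :: b :: c :: v) ++ [d])) :
      Reduced [a, b, c, (ContentWord.slide v d).1] := by
    have := hw.comm ((comm_slide v d).append_left [a, b, c])
    exact Reduced.of_append_left (v := (ContentWord.slide v d).2) (by simpa using this)
  induction h with
  | front a b c v h =>
    have := slide_front (key a b c v hw) h
    change (ContentWord.slide ([a, b, c] ++ v) d).1 = (ContentWord.slide ([b, a, c] ++ v) d).1 ∧
      Elem (ContentWord.slide ([a, b, c] ++ v) d).2 (ContentWord.slide ([b, a, c] ++ v) d).2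
    rw [slide_append, slide_append]
    exact ⟨this.1, this.2 _⟩
  | back a b c v h =>
    have := slide_back (key a b c v hw) h
    change (ContentWord.slide ([a, b, c] ++ v) d).1 = (ContentWord.slide ([a, c, b] ++ v) d).1 ∧
      Elem (ContentWord.slide ([a, b, c] ++ v) d).2 (ContentWord.slide ([a, c, b] ++ v) d).2
    rw [slide_append, slide_append]
    exact ⟨this.1, this.2 _⟩
  | cons a _ ih =>
    obtain ⟨h1, h2⟩ := ih (Reduced.of_append_right (u := [a]) hw)
    simp only [ContentWord.slide, h1]
    exact ⟨trivial, h2.cons _⟩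

lemma Elem.shuf {w w' : List ℤ} (h : Elem w w') (e : List ℤ) (hw : Reduced (w ++ e)) :
    (shuf w e).1 = (shuf w' e).1 ∧ Elem (shuf w e).2 (shuf w' e).2 := by
  induction e generalizing w w' with
  | nil => exact ⟨rfl, h⟩
  | cons d e ih =>
    have hw' : Reduced ((w ++ [d]) ++ e) := by simpa using hw
    obtain ⟨h1, h2⟩ := h.slide d hw'.of_append_left
    have := hw'.comm ((comm_slide w d).append_right e)
    obtain ⟨h3, h4⟩ := ih h2 (Reduced.of_append_right (u := [(ContentWord.slide w d).1]) this)
    simp only [ContentWord.shuf, h1, h3]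
    exact ⟨trivial, h4⟩

/-- Shuffling respects elementary equivalence of the left word. -/
lemma ElemEquiv.shuf_left {w w' : List ℤ} (h : ElemEquiv w w') (e : List ℤ)
    (hw : Reduced (w ++ e)) :
    (shuf w e).1 = (shuf w' e).1 ∧ ElemEquiv (shuf w e).2 (shuf w' e).2 := by
  induction h with
  | refl => exact ⟨rfl, .refl⟩
  | tail h1 h2 ih =>
    obtain ⟨h3, h4⟩ := h2.shuf e (hw.comm ((ElemEquiv.comm h1).append_right e))
    exact ⟨ih.1.trans h3, ih.2.tail h4⟩

/-- Shuffling respects elementary equivalence of the right word. -/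
lemma ElemEquiv.shuf_right (w : List ℤ) {e e' : List ℤ} (h : ElemEquiv e e')
    (hw : Reduced (w ++ e)) :
    ElemEquiv (shuf w e).1 (shuf w e').1 ∧ (shuf w e).2 = (shuf w e').2 := by
  have := ElemEquiv.shuf_left h.reverse w.reverse (by simpa using hw.reverse)
  rw [shuf_reverse, shuf_reverse] at this
  exact ⟨by simpa using ElemEquiv.reverse this.2, List.reverse_injective this.1⟩

end ContentWord

namespace YoungDiagram

/-! ### Adding a box with given content -/

/-- The content of a cell. -/
def content (x : ℕ × ℕ) : ℤ := (x.2 : ℤ) - x.1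

/-- `ν` is obtained from `μ` by adding the cell `x`. -/
def AddCell (μ : YoungDiagram) (x : ℕ × ℕ) (ν : YoungDiagram) : Prop :=
  x ∉ μ ∧ ∀ z, z ∈ ν ↔ z = x ∨ z ∈ μ

/-- `ν` is obtained from `μ` by adding a cell of content `c`. -/
def AddContent (μ : YoungDiagram) (c : ℤ) (ν : YoungDiagram) : Prop :=
  ∃ x, content x = c ∧ AddCell μ x ν

/-- The content of the cell added to `μ` to get `ν`. -/
def stepContent (μ ν : YoungDiagram) : ℤ := ∑ x ∈ ν.cells \ μ.cells, content x

variable {μ μ' lam lam' ν ν' : YoungDiagram} {x y : ℕ × ℕ} {a b c : ℤ}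

lemma eq_of_mem_iff (h : ∀ z, z ∈ μ ↔ z ∈ ν) : μ = ν := SetLike.ext h

lemma AddCell.le (h : AddCell μ x ν) : μ ≤ ν := fun z hz => (h.2 z).2 (.inr hz)

lemma AddCell.mem (h : AddCell μ x ν) : x ∈ ν := (h.2 x).2 (.inl rfl)

lemma AddCell.sdiff (h : AddCell μ x ν) : ν.cells \ μ.cells = {x} := by
  ext z
  simp only [Finset.mem_sdiff, mem_cells, Finset.mem_singleton, h.2]
  constructor
  · tauto
  · rintro rfl; exact ⟨.inl rfl, h.1⟩

lemma AddCell.stepContent_eq (h : AddCell μ x ν) : stepContent μ ν = content x := by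
  simp [stepContent, h.sdiff]

lemma AddCell.card (h : AddCell μ x ν) : ν.card = μ.card + 1 := by
  have := Finset.card_sdiff_add_card_eq_card (cells_subset_iff.2 h.le)
  rw [h.sdiff, Finset.card_singleton] at this
  change ν.cells.card = μ.cells.card + 1
  omega

lemma AddCell.addBox (h : AddCell μ x ν) : AddBox μ ν := ⟨h.le, h.card⟩

lemma _root_.AddBox.exists_addCell (h : AddBox μ ν) : ∃ x, AddCell μ x ν := by
  have h1 := Finset.card_sdiff_add_card_eq_card (cells_subset_iff.2 h.1)
  have h2 : ν.cells.card = μ.cells.card + 1 := h.2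
  obtain ⟨x, hx⟩ := Finset.card_eq_one.1 (show (ν.cells \ μ.cells).card = 1 by omega)
  have hx' (z) : (z ∈ ν ∧ z ∉ μ) ↔ z = x := by
    simpa using Finset.ext_iff.1 hx z
  refine ⟨x, ((hx' x).2 rfl).2, fun z => ?_⟩
  have := hx' z
  have := @h.1 z
  tauto

lemma addContent_iff : AddContent μ c ν ↔ AddBox μ ν ∧ stepContent μ ν = c := by
  constructor
  · rintro ⟨x, rfl, h⟩
    exact ⟨h.addBox, h.stepContent_eq⟩
  · rintro ⟨h, rfl⟩
    obtain ⟨x, hx⟩ := h.exists_addCell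
    exact ⟨x, hx.stepContent_eq.symm, hx⟩

lemma AddContent.addBox (h : AddContent μ c ν) : AddBox μ ν := (addContent_iff.1 h).1

lemma _root_.AddBox.addContent (h : AddBox μ ν) : AddContent μ (stepContent μ ν) ν :=
  addContent_iff.2 ⟨h, rfl⟩

/-- The cells preceding an addable cell belong to the diagram. -/
lemma AddCell.mem_of_le (h : AddCell μ x ν) {z : ℕ × ℕ} (hz : z ≤ x) (hne : z ≠ x) : z ∈ μ :=
  (((h.2 z).1 (ν.up_left_mem hz.1 hz.2 h.mem))).resolve_left hne

lemma exists_addCell (hx : x ∉ μ) (h : ∀ z, z ≤ x → z ≠ x → z ∈ μ) : ∃ ν, AddCell μ x ν := by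
  refine ⟨⟨insert x μ.cells, ?_⟩, hx, fun z => ?_⟩
  · intro u v hvu hu
    simp only [Finset.coe_insert, Set.mem_insert_iff, Finset.mem_coe, mem_cells] at hu ⊢
    by_cases hv : v = x
    · exact .inl hv
    · rcases hu with rfl | hu
      · exact .inr (h v hvu hv)
      · exact .inr (μ.up_left_mem hvu.1 hvu.2 hu)
  · rw [← mem_cells]
    simp

/-- Diagonally comparable cells have the same content. -/
lemma le_or_lt_of_content_eq (h : content x = content y) :
    x = y ∨ (x.1 < y.1 ∧ x.2 < y.2) ∨ (y.1 < x.1 ∧ y.2 < x.2) := by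
  unfold content at h
  rcases lt_trichotomy x.1 y.1 with h1 | h1 | h1
  · exact .inr (.inl ⟨h1, by omega⟩)
  · exact .inl (Prod.ext h1 (by omega))
  · exact .inr (.inr ⟨h1, by omega⟩)

lemma AddCell.not_lt (h : AddCell μ x ν) (hy : y ∉ μ) : ¬ (y.1 < x.1 ∧ y.2 < x.2) := by
  rintro ⟨h1, h2⟩
  exact hy (h.mem_of_le ⟨h1.le, h2.le⟩ (by rintro rfl; omega))

lemma AddCell.unique (h : AddCell μ x ν) (h' : AddCell μ x ν') : ν = ν' :=
  eq_of_mem_iff fun z => by rw [h.2, h'.2]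

lemma AddContent.unique (h : AddContent μ c ν) (h' : AddContent μ c ν') : ν = ν' := by
  obtain ⟨x, hx, h⟩ := h
  obtain ⟨y, hy, h'⟩ := h'
  have : x = y := by
    rcases le_or_lt_of_content_eq (hx.trans hy.symm) with h1 | h1 | h1
    · exact h1
    · exact (h'.not_lt h.1 h1).elim
    · exact (h.not_lt h'.1 h1).elim
  subst this
  exact h.unique h'

/-- Between two cells on one diagonal, two further cells have to be added. -/
lemma AddCell.exists_between (h : AddCell lam y ν) (hx : x ∈ lam) (hc : content x = content y) :
    (x.1, x.2 + 1) ∈ lam ∧ (x.1 + 1, x.2) ∈ lam := by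
  rcases le_or_lt_of_content_eq hc with rfl | h1 | h1
  · exact (h.1 hx).elim
  · constructor
    · exact h.mem_of_le ⟨h1.1.le, h1.2⟩ fun h => by rw [← h] at h1; simp at h1
    · exact h.mem_of_le ⟨h1.1, h1.2.le⟩ fun h => by rw [← h] at h1; simp at h1
  · exact (h.1 (lam.up_left_mem h1.1.le h1.2.le hx)).elim

lemma AddCell.right_notMem (h : AddCell μ x ν) : (x.1, x.2 + 1) ∉ μ :=
  fun h' => h.1 (μ.up_left_mem le_rfl (Nat.le_succ _) h')

lemma AddCell.below_notMem (h : AddCell μ x ν) : (x.1 + 1, x.2) ∉ μ :=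
  fun h' => h.1 (μ.up_left_mem (Nat.le_succ _) le_rfl h')

lemma AddContent.ne (h : AddContent μ a lam) (h' : AddContent lam b ν) : a ≠ b := by
  rintro rfl
  obtain ⟨x, rfl, h⟩ := h
  obtain ⟨y, hy, h'⟩ := h'
  have := (h'.exists_between h.mem hy.symm).1
  rcases (h.2 _).1 this with h1 | h1
  · simpa using congrArg Prod.snd h1
  · exact h.right_notMem h1

lemma AddContent.ne_of_two (h : AddContent μ a lam) (h' : AddContent lam b lam')
    (h'' : AddContent lam' c ν) : a ≠ c := by
  rintro rfl
  obtain ⟨x, rfl, h⟩ := h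
  obtain ⟨y, rfl, h'⟩ := h'
  obtain ⟨z, hz, h''⟩ := h''
  obtain ⟨h1, h2⟩ := h''.exists_between (h'.le h.mem) hz.symm
  have h3 : (x.1, x.2 + 1) = y := by
    refine ((h'.2 _).1 h1).resolve_right fun h3 => ?_
    rcases (h.2 _).1 h3 with h4 | h4
    · simpa using congrArg Prod.snd h4
    · exact h.right_notMem h4
  have h4 : (x.1 + 1, x.2) = y := by
    refine ((h'.2 _).1 h2).resolve_right fun h3 => ?_
    rcases (h.2 _).1 h3 with h4 | h4
    · simpa using congrArg Prod.fst h4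
    · exact h.below_notMem h4
  simpa using congrArg Prod.fst (h3.trans h4.symm)

/-- Two boxes added one after the other are comparable only if they are adjacent. -/
lemma AddCell.adj_of_le (h : AddCell μ x lam) (h' : AddCell lam y ν) (hxy : x ≤ y) :
    y = (x.1, x.2 + 1) ∨ y = (x.1 + 1, x.2) := by
  by_contra! hne
  have hne' : x ≠ y := fun e => h'.1 (e ▸ h.mem)
  have h1 : x.1 ≤ y.1 := hxy.1
  have h2 : x.2 ≤ y.2 := hxy.2
  have key (z : ℕ × ℕ) (hz : z ≤ y) (hzy : z ≠ y) (hzx : z ≠ x) : z ∈ μ :=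
    ((h.2 _).1 (h'.mem_of_le hz hzy)).resolve_left hzx
  rcases h2.lt_or_eq with h3 | h3
  · refine h.right_notMem (key _ ⟨h1, h3⟩ hne.1.symm fun h => ?_)
    simpa using congrArg Prod.snd h
  · have h4 : x.1 < y.1 := h1.lt_of_ne fun h => hne' (Prod.ext h h3)
    refine h.below_notMem (key _ ⟨h4, h2⟩ hne.2.symm fun h => ?_)
    simpa using congrArg Prod.fst h

lemma AddCell.le_of_adj (h : AddCell μ x lam) (h' : AddCell lam y ν)
    (hc : |content x - content y| = 1) : x ≤ y := by
  unfold content at hc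
  have h1 : ¬ y ≤ x := fun h1 => h'.1 (lam.up_left_mem h1.1 h1.2 h.mem)
  rw [Prod.le_def] at h1 ⊢
  grind

lemma AddCell.comm (h : AddCell μ x lam) (h' : AddCell lam y ν) (hxy : ¬ x ≤ y) :
    ∃ lam', AddCell μ y lam' ∧ AddCell lam' x ν := by
  have hy : y ∉ μ := fun h1 => h'.1 (h.le h1)
  obtain ⟨lam', hl⟩ := exists_addCell hy fun z hz hzy =>
    ((h.2 z).1 (h'.mem_of_le hz hzy)).resolve_left (by rintro rfl; exact hxy hz)
  refine ⟨lam', hl, fun hx => ?_, fun z => ?_⟩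
  · rcases (hl.2 x).1 hx with rfl | h1
    · exact hxy le_rfl
    · exact h.1 h1
  · rw [h'.2, h.2, hl.2]
    tauto

lemma AddCell.not_le_of_not_adj (h : AddCell μ x lam) (h' : AddCell lam y ν)
    (hc : |content x - content y| ≠ 1) : ¬ x ≤ y := by
  intro hxy
  rcases h.adj_of_le h' hxy with rfl | rfl <;> simp [content] at hc

lemma AddContent.comm (h : AddContent μ a lam) (h' : AddContent lam b ν) (hab : |a - b| ≠ 1) :
    ∃ lam', AddContent μ b lam' ∧ AddContent lam' a ν := by
  obtain ⟨x, rfl, h⟩ := h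
  obtain ⟨y, rfl, h'⟩ := h'
  obtain ⟨lam', h1, h2⟩ := h.comm h' (h.not_le_of_not_adj h' hab)
  exact ⟨lam', ⟨y, rfl, h1⟩, ⟨x, rfl, h2⟩⟩

/-! ### The local rule of growth diagrams -/

/-- The condition imposed on the two intermediate diagrams of a square of a growth diagram. -/
def LocalRule (μ lam lam' ν : YoungDiagram) : Prop :=
  (∃ c₁ ∈ ν.cells \ μ.cells, ∃ c₂ ∈ ν.cells \ μ.cells, c₁ ≠ c₂ ∧ ¬ CellAdj c₁ c₂) → lam ≠ lam'

lemma AddCell.mem_sdiff_iff (h : AddCell μ x lam) (h' : AddCell lam y ν) {z : ℕ × ℕ} :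
    z ∈ ν.cells \ μ.cells ↔ z = x ∨ z = y := by
  simp only [Finset.mem_sdiff, mem_cells, h'.2, h.2]
  constructor
  · tauto
  · rintro (rfl | rfl)
    · exact ⟨.inr (.inl rfl), h.1⟩
    · exact ⟨.inl rfl, fun h1 => h'.1 (h.le h1)⟩

lemma cellAdj_abs (h : CellAdj x y) : |content x - content y| = 1 := by
  unfold CellAdj at h
  unfold content
  grind

lemma LocalRule.sw_eq (hr : LocalRule μ lam lam' ν) (h1 : AddBox μ lam) (h2 : AddBox lam ν)
    (h3 : AddBox μ lam') (h4 : AddBox lam' ν) :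
    ContentWord.sw (stepContent μ lam) (stepContent lam ν) =
      (stepContent μ lam', stepContent lam' ν) := by
  obtain ⟨x, h1⟩ := h1.exists_addCell
  obtain ⟨y, h2⟩ := h2.exists_addCell
  obtain ⟨z, h3⟩ := h3.exists_addCell
  obtain ⟨w, h4⟩ := h4.exists_addCell
  rw [h1.stepContent_eq, h2.stepContent_eq, h3.stepContent_eq, h4.stepContent_eq]
  have hxy : x ≠ y := fun e => h2.1 (e ▸ h1.mem)
  have hzw : z ≠ w := fun e => h4.1 (e ▸ h3.mem)
  have hz : z = x ∨ z = y := (h1.mem_sdiff_iff h2).1 ((h3.mem_sdiff_iff h4).2 (.inl rfl))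
  have hw : w = x ∨ w = y := (h1.mem_sdiff_iff h2).1 ((h3.mem_sdiff_iff h4).2 (.inr rfl))
  by_cases hc : |content x - content y| = 1
  · have hle := h1.le_of_adj h2 hc
    rw [ContentWord.sw_of_adj hc]
    rcases hz with rfl | rfl
    · rw [hw.resolve_left hzw.symm]
    · exact (h1.1 (h3.mem_of_le hle hxy)).elim
  · rw [ContentWord.sw_of_not_adj hc]
    rcases hz with rfl | rfl
    · refine (hr ⟨z, (h1.mem_sdiff_iff h2).2 (.inl rfl), y, (h1.mem_sdiff_iff h2).2 (.inr rfl),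
        hxy, fun h => hc (cellAdj_abs h)⟩ (h1.unique h3)).elim
    · rw [hw.resolve_right hzw.symm]

lemma exists_localRule (h1 : AddBox μ lam) (h2 : AddBox lam ν) :
    ∃ lam', AddBox μ lam' ∧ AddBox lam' ν ∧ LocalRule μ lam lam' ν := by
  obtain ⟨x, h1⟩ := h1.exists_addCell
  obtain ⟨y, h2⟩ := h2.exists_addCell
  by_cases hle : x ≤ y
  · refine ⟨lam, h1.addBox, h2.addBox, ?_⟩
    rintro ⟨c₁, hc₁, c₂, hc₂, hne, hadj⟩
    rw [h1.mem_sdiff_iff h2] at hc₁ hc₂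
    refine (hadj ?_).elim
    unfold CellAdj
    rcases h1.adj_of_le h2 hle with rfl | rfl <;> rcases hc₁ with rfl | rfl <;>
      rcases hc₂ with rfl | rfl <;> first | exact (hne rfl).elim | simp
  · obtain ⟨lam', h3, h4⟩ := h1.comm h2 hle
    refine ⟨lam', h3.addBox, h4.addBox, fun _ e => ?_⟩
    subst e
    exact h2.1 h3.mem

/-! ### Paths of Young diagrams -/

/-- `w` is the word of contents of a chain of diagrams from `μ` to `ν`. -/
def Path : YoungDiagram → List ℤ → YoungDiagram → Prop
  | μ, [], ν => μ = ν
  | μ, c :: w, ν => ∃ lam, AddContent μ c lam ∧ Path lam w ν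

lemma path_append {u v : List ℤ} :
    Path μ (u ++ v) ν ↔ ∃ lam, Path μ u lam ∧ Path lam v ν := by
  induction u generalizing μ with
  | nil => simp [Path]
  | cons c u ih =>
    simp only [List.cons_append, Path, ih]
    constructor
    · rintro ⟨l, h, l', h', h''⟩
      exact ⟨l', ⟨l, h, h'⟩, h''⟩
    · rintro ⟨l', ⟨l, h, h'⟩, h''⟩
      exact ⟨l, h, l', h', h''⟩

lemma Path.unique {w : List ℤ} (h : Path μ w ν) (h' : Path μ w ν') : ν = ν' := by
  induction w generalizing μ with
  | nil => exact h.symm.trans h'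
  | cons c w ih =>
    obtain ⟨l, h1, h2⟩ := h
    obtain ⟨l', h3, h4⟩ := h'
    obtain rfl := h1.unique h3
    exact ih h2 h4

lemma Path.le {w : List ℤ} (h : Path μ w ν) : μ ≤ ν := by
  induction w generalizing μ with
  | nil => exact h.le
  | cons c w ih =>
    obtain ⟨l, h1, h2⟩ := h
    exact h1.addBox.1.trans (ih h2)

lemma Path.card {w : List ℤ} (h : Path μ w ν) : ν.card = μ.card + w.length := by
  induction w generalizing μ with
  | nil => exact congrArg _ h.symm
  | cons c w ih =>
    obtain ⟨l, h1, h2⟩ := h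
    rw [ih h2, h1.addBox.2, List.length_cons]
    omega

lemma Path.commStep {w w' : List ℤ} (hw : ContentWord.CommStep w w') (h : Path μ w ν) :
    Path μ w' ν := by
  induction hw generalizing μ with
  | swap a b v hab =>
    obtain ⟨l, h1, l', h2, h3⟩ := h
    obtain ⟨l'', h4, h5⟩ := h1.comm h2 hab
    exact ⟨l'', h4, l', h5, h3⟩
  | cons a _ ih =>
    obtain ⟨l, h1, h2⟩ := h
    exact ⟨l, h1, ih h2⟩

lemma Path.comm {w w' : List ℤ} (h : Path μ w ν) (hw : ContentWord.Comm w w') :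
    Path μ w' ν := by
  induction hw with
  | refl => exact h
  | tail _ h2 ih => exact ih.commStep h2

lemma Path.reduced {w : List ℤ} (h : Path μ w ν) : ContentWord.Reduced w := by
  intro w' hw u a b v
  have h' := h.comm hw
  constructor
  · rintro rfl
    obtain ⟨l, -, l', h1, l'', h2, -⟩ := path_append.1 h'
    exact h1.ne h2 rfl
  · rintro rfl
    obtain ⟨l, -, l', h1, l'', h2, l''', h3, -⟩ := path_append.1 h'
    exact h1.ne_of_two h2 h3 rfl

lemma exists_addCell_le (hle : μ ≤ ν) {z₀ : ℕ × ℕ} (h : z₀ ∈ ν) (h' : z₀ ∉ μ) :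
    ∃ z ≤ z₀, ∃ lam, AddCell μ z lam ∧ lam ≤ ν := by
  obtain ⟨z, hz, hmin⟩ := WellFounded.has_min (wellFounded_lt (α := ℕ × ℕ))
    {z | z ∉ μ ∧ z ≤ z₀} ⟨z₀, h', le_rfl⟩
  obtain ⟨lam, hl⟩ := exists_addCell hz.1 fun w hw hne => by
    by_contra hwμ
    exact hmin w ⟨hwμ, hw.trans hz.2⟩ (hw.lt_of_ne hne)
  refine ⟨z, hz.2, lam, hl, fun w hw => ?_⟩
  rcases (hl.2 w).1 hw with rfl | hw
  · exact ν.up_left_mem hz.2.1 hz.2.2 h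
  · exact hle hw

lemma exists_path (hle : μ ≤ ν) : ∃ w, Path μ w ν := by
  induction hn : ν.card - μ.card generalizing μ with
  | zero =>
    refine ⟨[], ?_⟩
    have : μ.cells = ν.cells :=
      Finset.eq_of_subset_of_card_le (cells_subset_iff.2 hle) (Nat.sub_eq_zero_iff_le.1 hn)
    exact YoungDiagram.ext this
  | succ n ih =>
    have hne : ¬ ν ≤ μ := fun h => by
      rw [le_antisymm h hle] at hn
      simp at hn
    obtain ⟨z₀, hz, hz'⟩ := Set.not_subset.1 hne
    obtain ⟨z, -, lam, hl, hlν⟩ := exists_addCell_le hle hz hz'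
    obtain ⟨w, hw⟩ := ih hlν (by rw [hl.card]; omega)
    exact ⟨_ :: w, lam, ⟨z, rfl, hl⟩, hw⟩

/-- The square Young diagram of side `n`. -/
def square (n : ℕ) : YoungDiagram where
  cells := Finset.range n ×ˢ Finset.range n
  isLowerSet := by
    intro x y hyx hx
    simp only [Finset.coe_product, Finset.coe_range, Set.mem_prod, Set.mem_Iio] at hx ⊢
    exact ⟨hyx.1.trans_lt hx.1, hyx.2.trans_lt hx.2⟩

lemma mem_square {n : ℕ} : x ∈ square n ↔ x.1 < n ∧ x.2 < n := by
  rw [← mem_cells]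
  simp [square]

lemma exists_le_square (μ : YoungDiagram) : ∃ n, μ ≤ square n := by
  refine ⟨μ.cells.sup (fun x => x.1 + x.2 + 1), fun x hx => mem_square.2 ?_⟩
  have := Finset.le_sup (f := fun x : ℕ × ℕ => x.1 + x.2 + 1) ((mem_cells x).2 hx)
  omega

/-- Two distinct cells addable to `μ` inside a square can be followed by a cell whose content
lies strictly between theirs. -/
lemma exists_addContent_between {n : ℕ} (hx : AddContent μ a lam) (hy : AddContent μ b lam')
    (hab : a ≠ b) (hl : lam ≤ square n) (hl' : lam' ≤ square n) :
    ∃ c ν ρ, ContentWord.Between c a b ∧ AddContent lam b ν ∧ AddContent lam' a ν ∧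
      AddContent ν c ρ ∧ ρ ≤ square n := by
  obtain ⟨x, rfl, hx⟩ := hx
  obtain ⟨y, rfl, hy⟩ := hy
  have hxy : x ≠ y := fun e => hab (by rw [e])
  have hx' : ¬ x ≤ y := fun h => hx.1 (hy.mem_of_le h hxy)
  have hy' : ¬ y ≤ x := fun h => hy.1 (hx.mem_of_le h hxy.symm)
  have hyl : y ∉ lam := fun h => hy.1 (((hx.2 y).1 h).resolve_left hxy.symm)
  obtain ⟨ν, hν⟩ := exists_addCell hyl fun z hz hzy => hx.le (hy.mem_of_le hz hzy)
  have hν' : AddCell lam' x ν := by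
    refine ⟨fun h => hx.1 (((hy.2 x).1 h).resolve_left hxy), fun z => ?_⟩
    rw [hν.2, hx.2, hy.2]
    tauto
  have hνn : ν ≤ square n := fun z hz => by
    rcases (hν.2 z).1 hz with rfl | hz
    · exact hl' hy.mem
    · exact hl hz
  have hmem (z : ℕ × ℕ) (hz : z ∈ ν) : z = x ∨ z = y ∨ z ∈ μ := by
    have := (hν.2 z).1 hz
    have := hx.2 z
    tauto
  have hxn := mem_square.1 (hl hx.mem)
  have hyn := mem_square.1 (hl' hy.mem)
  have hdom (z : ℕ × ℕ) (h1 : x ≤ z) (h2 : y ≤ z) : z ∉ ν := fun hz => by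
    rcases hmem z hz with rfl | rfl | h
    · exact hy' h2
    · exact hx' h1
    · exact hx.1 (μ.up_left_mem h1.1 h1.2 h)
  obtain ⟨z, hz, ρ, hρ, hρn⟩ := exists_addCell_le hνn (z₀ := x ⊔ y)
    (mem_square.2 ⟨max_lt hxn.1 hyn.1, max_lt hxn.2 hyn.2⟩)
    (hdom _ le_sup_left le_sup_right)
  refine ⟨content z, ν, ρ, ?_, ⟨y, rfl, hν⟩, ⟨x, rfl, hν'⟩, ⟨z, rfl, hρ⟩, hρn⟩
  have hzx : ¬ z ≤ x := fun h => hρ.1 (ν.up_left_mem h.1 h.2 hν'.mem)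
  have hzy : ¬ z ≤ y := fun h => hρ.1 (ν.up_left_mem h.1 h.2 hν.mem)
  have h1 : z.1 ≤ max x.1 y.1 := hz.1
  have h2 : z.2 ≤ max x.2 y.2 := hz.2
  rw [Prod.le_def] at hx' hy' hzx hzy
  unfold ContentWord.Between content
  omega

/-- All paths from a given diagram to a square are elementarily equivalent. -/
lemma Path.elemEquiv {n : ℕ} {w w' : List ℤ} (h : Path μ w (square n))
    (h' : Path μ w' (square n)) : ContentWord.ElemEquiv w w' := by
  induction hk : w.length using Nat.strong_induction_on generalizing μ w w' with
  | _ k ih =>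
    subst hk
    match w, w', h, h' with
    | [], [], _, _ => exact .refl
    | [], c :: v, h, h' => cases h; simpa using h'.card
    | c :: v, [], h, h' => cases h'; simpa using h.card
    | a :: u, b :: v, ⟨l, h1, h2⟩, ⟨l', h3, h4⟩ =>
      by_cases hab : a = b
      · subst hab
        obtain rfl := h1.unique h3
        exact (ih _ (by simp) h2 h4 rfl).cons a
      · obtain ⟨c, ν, ρ, hc, h5, h6, h7, h8⟩ :=
          exists_addContent_between h1 h3 hab h2.le h4.le
        obtain ⟨t, ht⟩ := exists_path h8
        have h9 : Path l (b :: c :: t) (square n) := ⟨ν, h5, ρ, h7, ht⟩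
        have h10 : Path l' (a :: c :: t) (square n) := ⟨ν, h6, ρ, h7, ht⟩
        have hlen : (a :: c :: t).length = u.length := by
          have := h2.card
          have := h9.card
          simp only [List.length_cons] at *
          omega
        have e1 := ih _ (by simp) h2 h9 rfl
        have e2 := ih _ (by simp only [hlen]; simp) h10 h4 rfl
        exact ((e1.cons a).tail (.front a b c t hc)).trans (e2.cons b)

end YoungDiagram

namespace YoungDiagram

/-! ### Chains and grids of Young diagrams -/

/-- The word of contents of the first `n` steps of a chain. -/
def wordOf (f : ℕ → YoungDiagram) : ℕ → List ℤ
  | 0 => []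
  | n + 1 => stepContent (f 0) (f 1) :: wordOf (fun t => f (t + 1)) n

lemma path_wordOf {f : ℕ → YoungDiagram} {n : ℕ} (h : ∀ t < n, AddBox (f t) (f (t + 1))) :
    Path (f 0) (wordOf f n) (f n) := by
  induction n generalizing f with
  | zero => rfl
  | succ n ih =>
    exact ⟨f 1, (h 0 (by omega)).addContent, ih (f := fun t => f (t + 1)) fun t ht =>
      h (t + 1) (by omega)⟩

lemma eq_of_wordOf_eq {f g : ℕ → YoungDiagram} {n : ℕ}
    (hf : ∀ t < n, AddBox (f t) (f (t + 1))) (hg : ∀ t < n, AddBox (g t) (g (t + 1)))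
    (h0 : f 0 = g 0) (h : wordOf f n = wordOf g n) : ∀ t ≤ n, f t = g t := by
  induction n generalizing f g with
  | zero =>
    intro t ht
    rw [Nat.le_zero.1 ht, h0]
  | succ n ih =>
    simp only [wordOf, List.cons.injEq] at h
    have h1 : f 1 = g 1 := by
      have h2 := (hf 0 (by omega)).addContent
      have h3 := (hg 0 (by omega)).addContent
      rw [zero_add, h.1, h0] at h2
      exact h2.unique h3
    rintro (_ | t) ht
    · exact h0
    · exact ih (f := fun t => f (t + 1)) (g := fun t => g (t + 1))
        (fun t ht => hf (t + 1) (by omega)) (fun t ht => hg (t + 1) (by omega)) h1 h.2 t (by omega)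

/-- Two consecutive columns of a growth diagram. -/
structure IsStrip (n : ℕ) (f g : ℕ → YoungDiagram) : Prop where
  left : ∀ t < n, AddBox (f t) (f (t + 1))
  right : ∀ t < n, AddBox (g t) (g (t + 1))
  across : ∀ t ≤ n, AddBox (f t) (g t)
  rule : ∀ t < n, LocalRule (f t) (f (t + 1)) (g t) (g (t + 1))

lemma IsStrip.slide_eq {n : ℕ} {f g : ℕ → YoungDiagram} (h : IsStrip n f g) :
    ContentWord.slide (wordOf f n) (stepContent (f n) (g n)) =
      (stepContent (f 0) (g 0), wordOf g n) := by
  induction n generalizing f g with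
  | zero => rfl
  | succ n ih =>
    have h' : IsStrip n (fun t => f (t + 1)) (fun t => g (t + 1)) :=
      ⟨fun t ht => h.left _ (by omega), fun t ht => h.right _ (by omega),
        fun t ht => h.across _ (by omega), fun t ht => h.rule _ (by omega)⟩
    have h0 := (h.rule 0 (by omega)).sw_eq (h.left 0 (by omega)) (h.across 1 (by omega))
      (h.across 0 (by omega)) (h.right 0 (by omega))
    simp only [zero_add] at h0
    simp only [wordOf, ContentWord.slide, ih h', zero_add, h0]

lemma exists_isStrip {n : ℕ} {f : ℕ → YoungDiagram} {ν : YoungDiagram}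
    (hf : ∀ t < n, AddBox (f t) (f (t + 1))) (hν : AddBox (f n) ν) :
    ∃ g, g n = ν ∧ IsStrip n f g := by
  induction n generalizing f with
  | zero =>
    exact ⟨fun _ => ν, rfl, by simp, by simp, fun t ht => by rwa [Nat.le_zero.1 ht], by simp⟩
  | succ n ih =>
    obtain ⟨g, hg, h⟩ := ih (f := fun t => f (t + 1)) (fun t ht => hf (t + 1) (by omega)) hν
    obtain ⟨l, h1, h2, h3⟩ := exists_localRule (hf 0 (by omega)) (h.across 0 (by omega))
    refine ⟨fun t => Nat.casesOn t l g, hg, hf, ?_, ?_, ?_⟩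
    · rintro (_ | t) ht
      exacts [h2, h.right t (by omega)]
    · rintro (_ | t) ht
      exacts [h1, h.across t (by omega)]
    · rintro (_ | t) ht
      exacts [h3, h.rule t (by omega)]

/-- A growth diagram with `n + 1` rows and `k + 1` columns, indexed by natural numbers. -/
def IsGrid (k n : ℕ) (G : ℕ → ℕ → YoungDiagram) : Prop :=
  (∀ t < n, AddBox (G 0 t) (G 0 (t + 1))) ∧ ∀ s < k, IsStrip n (G s) (G (s + 1))

lemma IsGrid.addBox_right {k n : ℕ} {G : ℕ → ℕ → YoungDiagram} (h : IsGrid k n G) {s t : ℕ}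
    (hs : s ≤ k) (ht : t < n) : AddBox (G s t) (G s (t + 1)) := by
  cases s with
  | zero => exact h.1 t ht
  | succ s => exact (h.2 s hs).right t ht

lemma IsGrid.shuf_eq {k n : ℕ} {G : ℕ → ℕ → YoungDiagram} (h : IsGrid k n G) :
    ContentWord.shuf (wordOf (G 0) n) (wordOf (fun s => G s n) k) =
      (wordOf (fun s => G s 0) k, wordOf (G k) n) := by
  induction k generalizing G with
  | zero => rfl
  | succ k ih =>
    have h' : IsGrid k n (fun s => G (s + 1)) :=
      ⟨(h.2 0 (by omega)).right, fun s hs => h.2 (s + 1) (by omega)⟩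
    have := ih h'
    simp only [zero_add] at this
    simp only [wordOf, ContentWord.shuf, (h.2 0 (by omega)).slide_eq, zero_add, this]

lemma exists_isGrid {k n : ℕ} {f e : ℕ → YoungDiagram}
    (hf : ∀ t < n, AddBox (f t) (f (t + 1))) (he : ∀ s < k, AddBox (e s) (e (s + 1)))
    (h0 : f n = e 0) : ∃ G, IsGrid k n G ∧ G 0 = f ∧ ∀ s ≤ k, G s n = e s := by
  induction k generalizing f e with
  | zero =>
    exact ⟨fun _ => f, ⟨hf, by simp⟩, rfl, fun s hs => by
      obtain rfl := Nat.le_zero.1 hs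
      exact h0⟩
  | succ k ih =>
    obtain ⟨g, hg, h⟩ := exists_isStrip hf (h0 ▸ he 0 (by omega))
    obtain ⟨G, hG, rfl, hG'⟩ := ih (e := fun s => e (s + 1)) h.right
      (fun s hs => he (s + 1) (by omega)) hg
    refine ⟨fun s => Nat.casesOn s f G, ⟨hf, ?_⟩, rfl, ?_⟩
    · rintro (_ | s) hs
      exacts [h, hG.2 s (by omega)]
    · rintro (_ | s) hs
      exacts [h0, hG' s (by omega)]

lemma _root_.IsShuffle.exists_isGrid {m q p : ℕ} {δ ε ε' δ' : ℕ → YoungDiagram} (hm : m ≤ q)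
    (h : IsShuffle m q p δ ε ε' δ') :
    ∃ G, IsGrid (p - q) (q - m) G ∧ (∀ t ≤ q - m, G 0 t = δ t) ∧ (∀ s ≤ p - q, G s (q - m) = ε s) ∧
      (∀ s ≤ p - q, G s 0 = ε' s) ∧ ∀ t ≤ q - m, G (p - q) t = δ' t := by
  obtain ⟨g, h1, h2, h3, h4⟩ := h
  have hr (s t : ℕ) (hs : s ≤ p - q) (ht : t < q - m) :
      AddBox (g.γ (-(s : ℤ)) (m + t)) (g.γ (-(s : ℤ)) (m + (t + 1 : ℕ))) := by
    have := g.grow_right (-(s : ℤ)) (m + t) (by omega) (by omega) (by omega) (by omega)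
    rwa [add_assoc] at this
  have hneg (s : ℕ) : -((s + 1 : ℕ) : ℤ) = -(s : ℤ) - 1 := by push_cast; ring
  refine ⟨fun s t => g.γ (-(s : ℤ)) (m + t), ⟨fun t ht => hr 0 t (by omega) ht, fun s hs =>
    ⟨fun t ht => hr s t hs.le ht, fun t ht => hr (s + 1) t hs ht, fun t ht => ?_, fun t ht => ?_⟩⟩,
    h1, fun s hs => ?_, fun s hs => ?_, h4⟩
  · simp only [hneg]
    exact g.grow_up _ _ (by omega) (by omega) (by omega) (by omega)
  · have := g.nonadj (-(s : ℤ)) (m + t) (by omega) (by omega) (by omega) (by omega)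
    simp only [hneg]
    simp only [Nat.cast_add, Nat.cast_one, ← add_assoc]
    exact this
  · have e : (m : ℤ) + ((q - m : ℕ) : ℤ) = q := by omega
    simp only [e]
    exact h2 s hs
  · simpa using h3 s hs

lemma IsGrid.isShuffle {m q p : ℕ} (hm : m ≤ q) {G : ℕ → ℕ → YoungDiagram}
    (h : IsGrid (p - q) (q - m) G) :
    IsShuffle m q p (G 0) (fun s => G s (q - m)) (fun s => G s 0) (G (p - q)) := by
  classical
  have hval (i j : ℤ) (s t : ℕ) (hi : i = -(s : ℤ)) (hj : j = m + t) (hs : s ≤ p - q)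
      (ht : t ≤ q - m) :
      (if -((p - q : ℕ) : ℤ) ≤ i ∧ i ≤ 0 ∧ (m : ℤ) ≤ j ∧ j ≤ q then
        G (-i).toNat (j - m).toNat else ⊥) = G s t := by
    rw [if_pos (by omega)]
    congr 1 <;> omega
  refine ⟨⟨fun i j => if -((p - q : ℕ) : ℤ) ≤ i ∧ i ≤ 0 ∧ (m : ℤ) ≤ j ∧ j ≤ q then
    G (-i).toNat (j - m).toNat else ⊥, fun i j hij => if_neg hij, fun i j h1 h2 h3 h4 => ?_,
    fun i j h1 h2 h3 h4 => ?_, fun i j h1 h2 h3 h4 => ?_⟩, fun t ht => ?_, fun t ht => ?_,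
    fun t ht => ?_, fun t ht => ?_⟩
  · rw [hval i j (-i).toNat (j - m).toNat, hval i (j + 1) (-i).toNat ((j - m).toNat + 1)]
    · exact h.addBox_right (by omega) (by omega)
    all_goals omega
  · rw [hval i j (-i).toNat (j - m).toNat, hval (i - 1) j ((-i).toNat + 1) (j - m).toNat]
    · exact (h.2 _ (by omega)).across _ (by omega)
    all_goals omega
  · rw [hval i j (-i).toNat (j - m).toNat, hval i (j + 1) (-i).toNat ((j - m).toNat + 1),
      hval (i - 1) j ((-i).toNat + 1) (j - m).toNat,
      hval (i - 1) (j + 1) ((-i).toNat + 1) ((j - m).toNat + 1)]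
    · exact (h.2 _ (by omega)).rule _ (by omega)
    all_goals omega
  · exact hval _ _ _ _ (by omega) (by omega) (by omega) (by omega)
  · exact hval _ _ _ _ (by omega) (by omega) (by omega) (by omega)
  · exact hval _ _ _ _ (by omega) (by omega) (by omega) (by omega)
  · exact hval _ _ _ _ (by omega) (by omega) (by omega) (by omega)

lemma wordOf_congr {f g : ℕ → YoungDiagram} {n : ℕ} (h : ∀ t ≤ n, f t = g t) :
    wordOf f n = wordOf g n := by
  induction n generalizing f g with
  | zero => rfl
  | succ n ih =>
    simp only [wordOf, h 0 (by omega), h 1 (by omega)]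
    rw [ih fun t ht => h (t + 1) (by omega)]

lemma IsGrid.addBox_up {k n : ℕ} {G : ℕ → ℕ → YoungDiagram} (h : IsGrid k n G) {s t : ℕ}
    (hs : s < k) (ht : t ≤ n) : AddBox (G s t) (G (s + 1) t) :=
  (h.2 s hs).across t ht

/-! ### Dual equivalence and words -/

lemma _root_.IsSYTChain.path {μ ν : YoungDiagram} {T : ℕ → YoungDiagram}
    (h : IsSYTChain μ ν T) : Path μ (wordOf T (ν.card - μ.card)) ν := by
  have := path_wordOf h.2.2.2
  rwa [h.2.1, h.2.2.1] at this

lemma isSYTChain_of_addBox {T : ℕ → YoungDiagram} {n : ℕ}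
    (h : ∀ t < n, AddBox (T t) (T (t + 1))) :
    IsSYTChain (T 0) (T n) T ∧ (T n).card = (T 0).card + n := by
  have hc : ∀ t ≤ n, (T t).card = (T 0).card + t := fun t ht => by
    induction t with
    | zero => rfl
    | succ t ih =>
      rw [(h t ht).2, ih (by omega)]
      omega
  have hn := hc n le_rfl
  have hn' : (T n).card - (T 0).card = n := by omega
  refine ⟨⟨(path_wordOf h).le, rfl, by rw [hn'], ?_⟩, hn⟩
  rwa [hn']

lemma exists_isSYTChain {μ ν : YoungDiagram} (h : μ ≤ ν) : ∃ T, IsSYTChain μ ν T := by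
  obtain ⟨w, hw⟩ := exists_path h
  have key : ∃ T : ℕ → YoungDiagram, T 0 = μ ∧ T w.length = ν ∧
      ∀ t < w.length, AddBox (T t) (T (t + 1)) := by
    clear h
    induction w generalizing μ with
    | nil => exact ⟨fun _ => μ, rfl, hw, by simp⟩
    | cons c w ih =>
      obtain ⟨l, h1, h2⟩ := hw
      obtain ⟨T, h3, h4, h5⟩ := ih h2
      refine ⟨fun t => Nat.casesOn t μ T, rfl, h4, ?_⟩
      rintro (_ | t) ht
      · simpa [h3] using h1.addBox
      · exact h5 t (by simpa using ht)
  obtain ⟨T, rfl, rfl, h5⟩ := key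
  exact ⟨T, (isSYTChain_of_addBox h5).1⟩

lemma _root_.IsShuffle.shuf_eq {μ ν π : YoungDiagram} {δ ε ε' δ' : ℕ → YoungDiagram}
    (hδ : IsSYTChain μ ν δ) (hε : IsSYTChain ν π ε)
    (h : IsShuffle μ.card ν.card π.card δ ε ε' δ') :
    ∃ ν', IsSYTChain μ ν' ε' ∧ IsSYTChain ν' π δ' ∧
      ν'.card - μ.card = π.card - ν.card ∧ π.card - ν'.card = ν.card - μ.card ∧
      ContentWord.shuf (wordOf δ (ν.card - μ.card)) (wordOf ε (π.card - ν.card)) =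
        (wordOf ε' (π.card - ν.card), wordOf δ' (ν.card - μ.card)) := by
  have hμν := Finset.card_le_card (cells_subset_iff.2 hδ.1)
  obtain ⟨G, hG, h1, h2, h3, h4⟩ := IsShuffle.exists_isGrid hμν h
  have h5 (s) (hs : s < π.card - ν.card) : AddBox (ε' s) (ε' (s + 1)) := by
    rw [← h3 s hs.le, ← h3 (s + 1) hs]
    exact hG.addBox_up hs (Nat.zero_le _)
  have h6 (t) (ht : t < ν.card - μ.card) : AddBox (δ' t) (δ' (t + 1)) := by
    rw [← h4 t ht.le, ← h4 (t + 1) ht]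
    exact hG.addBox_right le_rfl ht
  have e1 : ε' 0 = μ := by rw [← h3 0 (Nat.zero_le _), h1 0 (Nat.zero_le _), hδ.2.1]
  have e2 : δ' 0 = ε' (π.card - ν.card) := by rw [← h4 0 (Nat.zero_le _), h3 _ le_rfl]
  have e3 : δ' (ν.card - μ.card) = π := by rw [← h4 _ le_rfl, h2 _ le_rfl, hε.2.2.1]
  obtain ⟨h7, h8⟩ := isSYTChain_of_addBox h5
  obtain ⟨h9, h10⟩ := isSYTChain_of_addBox h6
  rw [e1] at h7 h8
  rw [e2, e3] at h9 h10
  refine ⟨_, h7, h9, by omega, by omega, ?_⟩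
  rw [← wordOf_congr h1, ← wordOf_congr h2, ← wordOf_congr h3, ← wordOf_congr h4]
  exact hG.shuf_eq

lemma exists_isShuffle {μ ν π : YoungDiagram} {δ ε : ℕ → YoungDiagram}
    (hδ : IsSYTChain μ ν δ) (hε : IsSYTChain ν π ε) :
    ∃ ε' δ', IsShuffle μ.card ν.card π.card δ ε ε' δ' := by
  have hμν := Finset.card_le_card (cells_subset_iff.2 hδ.1)
  obtain ⟨G, hG, rfl, hG'⟩ := exists_isGrid hδ.2.2.2 hε.2.2.2 (hδ.2.2.1.trans hε.2.1.symm)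
  obtain ⟨g, a, b, c, d⟩ := hG.isShuffle hμν
  exact ⟨_, _, g, a, fun t ht => (b t ht).trans (hG' t ht), c, d⟩

/-- Dual equivalence is elementary equivalence of words. -/
theorem dualEquiv_iff {μ ν : YoungDiagram} {δ₁ δ₂ : ℕ → YoungDiagram} :
    DualEquiv μ ν δ₁ δ₂ ↔ IsSYTChain μ ν δ₁ ∧ IsSYTChain μ ν δ₂ ∧
      ContentWord.ElemEquiv (wordOf δ₁ (ν.card - μ.card)) (wordOf δ₂ (ν.card - μ.card)) := by
  constructor
  · rintro ⟨h₁, h₂, h⟩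
    refine ⟨h₁, h₂, ?_⟩
    obtain ⟨n, hn⟩ := exists_le_square ν
    obtain ⟨τ, hτ⟩ := exists_isSYTChain hn
    obtain ⟨ε₁, η₁, hs₁⟩ := exists_isShuffle h₁ hτ
    obtain ⟨ε₂, η₂, hs₂⟩ := exists_isShuffle h₂ hτ
    have hε := wordOf_congr (h _ _ _ _ _ _ hτ hs₁ hs₂)
    obtain ⟨l₁, a₁, b₁, c₁, d₁, e₁⟩ := hs₁.shuf_eq h₁ hτ
    obtain ⟨l₂, a₂, b₂, c₂, d₂, e₂⟩ := hs₂.shuf_eq h₂ hτ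
    have pa₁ := a₁.path
    have pb₁ := b₁.path
    have pa₂ := a₂.path
    have pb₂ := b₂.path
    rw [c₁] at pa₁
    rw [d₁] at pb₁
    rw [c₂, ← hε] at pa₂
    rw [d₂] at pb₂
    obtain rfl := pa₁.unique pa₂
    have key := (ContentWord.ElemEquiv.shuf_right _ (pb₁.elemEquiv pb₂)
      (path_append.2 ⟨_, pa₁, pb₁⟩).reduced).1
    have i₁ := ContentWord.shuf_shuf (wordOf δ₁ (ν.card - μ.card))
      (wordOf τ ((square n).card - ν.card))
    have i₂ := ContentWord.shuf_shuf (wordOf δ₂ (ν.card - μ.card))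
      (wordOf τ ((square n).card - ν.card))
    rw [e₁] at i₁
    rw [e₂, ← hε] at i₂
    rwa [i₁, i₂] at key
  · rintro ⟨h₁, h₂, h⟩
    refine ⟨h₁, h₂, fun π ε ε₁ η₁ ε₂ η₂ hε hs₁ hs₂ => ?_⟩
    obtain ⟨l₁, a₁, b₁, c₁, d₁, e₁⟩ := hs₁.shuf_eq h₁ hε
    obtain ⟨l₂, a₂, b₂, c₂, d₂, e₂⟩ := hs₂.shuf_eq h₂ hε
    have key := (h.shuf_left _ (path_append.2 ⟨_, h₁.path, hε.path⟩).reduced).1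
    rw [e₁, e₂] at key
    exact eq_of_wordOf_eq (c₁ ▸ a₁.2.2.2) (c₂ ▸ a₂.2.2.2) (a₁.2.1.trans a₂.2.1.symm) key

end YoungDiagram


/-- **Shuffling respects dual equivalence.** Let `μ ⊆ ν ⊆ π`, let `δ₁, δ₂` be dual
equivalent standard tableaux of shape `ν/μ` and `ε₁, ε₂` dual equivalent standard
tableaux of shape `π/ν`; let `(ε'ₖ, δ'ₖ)` be the shuffle of `(δₖ, εₖ)`. Then
`ε'₁, ε'₂` have the same shape `ν'/μ` and are dual equivalent, and `δ'₁, δ'₂` have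
the same shape `π/ν'` and are dual equivalent. -/
theorem stmt12 (μ ν π : YoungDiagram)
    (δ₁ δ₂ ε₁ ε₂ ε₁' δ₁' ε₂' δ₂' : ℕ → YoungDiagram)
    (hδ : DualEquiv μ ν δ₁ δ₂) (hε : DualEquiv ν π ε₁ ε₂)
    (h₁ : IsShuffle μ.card ν.card π.card δ₁ ε₁ ε₁' δ₁')
    (h₂ : IsShuffle μ.card ν.card π.card δ₂ ε₂ ε₂' δ₂') :
    ∃ ν' : YoungDiagram,
      IsSYTChain μ ν' ε₁' ∧ IsSYTChain μ ν' ε₂' ∧ DualEquiv μ ν' ε₁' ε₂' ∧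
      IsSYTChain ν' π δ₁' ∧ IsSYTChain ν' π δ₂' ∧ DualEquiv ν' π δ₁' δ₂' := by
  obtain ⟨d₁, d₂, hd⟩ := YoungDiagram.dualEquiv_iff.1 hδ
  obtain ⟨e₁, e₂, he⟩ := YoungDiagram.dualEquiv_iff.1 hε
  obtain ⟨l₁, a₁, b₁, m₁, n₁, s₁⟩ := h₁.shuf_eq d₁ e₁
  obtain ⟨l₂, a₂, b₂, m₂, n₂, s₂⟩ := h₂.shuf_eq d₂ e₂
  obtain ⟨p, p'⟩ := hd.shuf_left _ (YoungDiagram.path_append.2 ⟨_, d₁.path, e₁.path⟩).reduced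
  obtain ⟨r, r'⟩ := ContentWord.ElemEquiv.shuf_right _ he
    (YoungDiagram.path_append.2 ⟨_, d₂.path, e₁.path⟩).reduced
  rw [← p, s₁, s₂] at r
  rw [r', s₁, s₂] at p'
  have q₁ := a₁.path
  have q₂ := a₂.path
  rw [m₁] at q₁
  rw [m₂] at q₂
  obtain rfl := (q₁.comm r.comm).unique q₂
  rw [← m₁] at r
  rw [← n₁] at p'
  exact ⟨l₁, a₁, a₂, YoungDiagram.dualEquiv_iff.2 ⟨a₁, a₂, r⟩,
    b₁, b₂, YoungDiagram.dualEquiv_iff.2 ⟨b₁, b₂, p'⟩⟩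
end

section
/- Let μ be a Young diagram, let ε be a standard Young tableau of shape μ/∅ (a straight-shape tableau), and let δ be a standard Young tableau (of some skew shape) that is slide equivalent to some standard Young tableau of shape μ/∅. Then there exists exactly one standard Young tableau φ such that φ is slide equivalent to ε and φ is dual equivalent to δ. -/
/-- A skew standard Young tableau, encoded as a triple: inner shape, outer shape,
and the chain. -/
abbrev SkewTab := YoungDiagram × YoungDiagram × (ℕ → YoungDiagram)

/-- The basic slide move: one of the two components of a shuffle. -/
def ShuffleMove (x y : SkewTab) : Prop :=
  ∃ (μ ν π ν' : YoungDiagram) (δ ε ε' δ' : ℕ → YoungDiagram),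
    IsSYTChain μ ν δ ∧ IsSYTChain ν π ε ∧
    IsShuffle μ.card ν.card π.card δ ε ε' δ' ∧
    IsSYTChain μ ν' ε' ∧ IsSYTChain ν' π δ' ∧
    ((x = (μ, ν, δ) ∧ y = (ν', π, δ')) ∨ (x = (ν, π, ε) ∧ y = (μ, ν', ε')))

/-- Slide equivalence: the smallest equivalence relation such that whenever
`(δ, ε)` shuffles to `(ε', δ')`, `δ` is slide equivalent to `δ'` and `ε` is slide
equivalent to `ε'`. -/
def SlideEquiv : SkewTab → SkewTab → Prop := Relation.EqvGen ShuffleMove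

/-- The local rule on contents: swap two consecutive contents unless they differ by at most one. -/
def contentSwap (a b : ℤ) : ℤ × ℤ := if a + 2 ≤ b ∨ b + 2 ≤ a then (b, a) else (a, b)

theorem contentSwap_contentSwap (a b : ℤ) :
    contentSwap (contentSwap a b).1 (contentSwap a b).2 = (a, b) := by
  unfold contentSwap
  split_ifs <;> first | rfl | (exfalso; simp_all; done) | (exfalso; simp_all; omega)

theorem contentSwap_cases (a b : ℤ) : ∃ x y, contentSwap a b = (x, y) ∧
    ((a + 2 ≤ b ∨ b + 2 ≤ a) ∧ x = b ∧ y = a ∨ ¬(a + 2 ≤ b ∨ b + 2 ≤ a) ∧ x = a ∧ y = b) := by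
  by_cases h : a + 2 ≤ b ∨ b + 2 ≤ a
  · exact ⟨b, a, if_pos h, .inl ⟨h, rfl, rfl⟩⟩
  · exact ⟨a, b, if_neg h, .inr ⟨h, rfl, rfl⟩⟩

/-- Move the letter `c` from the right end of the word to its left end. -/
def slideLetter : List ℤ → ℤ → ℤ × List ℤ
  | [], c => (c, [])
  | a :: w, c =>
    ((contentSwap a (slideLetter w c).1).1,
      (contentSwap a (slideLetter w c).1).2 :: (slideLetter w c).2)

/-- The shuffle of two content words. -/
def wordShuffle : List ℤ → List ℤ → List ℤ × List ℤ
  | u, [] => ([], u)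
  | u, c :: v =>
    ((slideLetter u c).1 :: (wordShuffle (slideLetter u c).2 v).1,
      (wordShuffle (slideLetter u c).2 v).2)

theorem slideLetter_append (u₁ u₂ : List ℤ) (c : ℤ) :
    slideLetter (u₁ ++ u₂) c =
      ((slideLetter u₁ (slideLetter u₂ c).1).1,
        (slideLetter u₁ (slideLetter u₂ c).1).2 ++ (slideLetter u₂ c).2) := by
  induction u₁ with
  | nil => simp [slideLetter]
  | cons a u ih => simp [slideLetter, ih]

@[simp] theorem wordShuffle_nil_right (u : List ℤ) : wordShuffle u [] = ([], u) := by
  cases u <;> rfl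

@[simp] theorem wordShuffle_nil_left (v : List ℤ) : wordShuffle [] v = (v, []) := by
  induction v with
  | nil => rfl
  | cons c v ih => simp [wordShuffle, slideLetter, ih]

theorem wordShuffle_append_left (u₁ u₂ v : List ℤ) :
    wordShuffle (u₁ ++ u₂) v =
      ((wordShuffle u₁ (wordShuffle u₂ v).1).1,
        (wordShuffle u₁ (wordShuffle u₂ v).1).2 ++ (wordShuffle u₂ v).2) := by
  induction v generalizing u₁ u₂ with
  | nil => simp
  | cons c v ih => simp [wordShuffle, slideLetter_append, ih]

theorem wordShuffle_append_right (u v₁ v₂ : List ℤ) :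
    wordShuffle u (v₁ ++ v₂) =
      ((wordShuffle u v₁).1 ++ (wordShuffle (wordShuffle u v₁).2 v₂).1,
        (wordShuffle (wordShuffle u v₁).2 v₂).2) := by
  induction v₁ generalizing u with
  | nil => simp
  | cons c v ih => simp [wordShuffle, ih]

theorem wordShuffle_singleton_slideLetter (u : List ℤ) (c : ℤ) :
    wordShuffle [(slideLetter u c).1] (slideLetter u c).2 = (u, [c]) := by
  induction u with
  | nil => simp [slideLetter]
  | cons a u ih => simp [wordShuffle, slideLetter, contentSwap_contentSwap, ih]

theorem wordShuffle_wordShuffle (u v : List ℤ) :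
    wordShuffle (wordShuffle u v).1 (wordShuffle u v).2 = (u, v) := by
  induction v generalizing u with
  | nil => simp
  | cons c v ih =>
    have h := wordShuffle_append_left [(slideLetter u c).1]
      (wordShuffle (slideLetter u c).2 v).1 (wordShuffle (slideLetter u c).2 v).2
    rw [ih, wordShuffle_singleton_slideLetter] at h
    simpa [wordShuffle] using h

/-- Elementary dual equivalence of three-letter content words. -/
inductive ElemTriple : List ℤ → List ℤ → Prop
  | first {a b c : ℤ} (h : b < a ∧ a < c ∨ c < a ∧ a < b) : ElemTriple [a, b, c] [a, c, b]
  | last {a b c : ℤ} (h : a < c ∧ c < b ∨ b < c ∧ c < a) : ElemTriple [a, b, c] [b, a, c]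

theorem ElemTriple.reverse {t t' : List ℤ} (h : ElemTriple t t') :
    ElemTriple t.reverse t'.reverse := by
  cases h with
  | first h => exact .last h.symm
  | last h => exact .first h.symm

theorem ElemTriple.map_neg {t t' : List ℤ} (h : ElemTriple t t') :
    ElemTriple (t.map Neg.neg) (t'.map Neg.neg) := by
  cases h with
  | first h => exact .first (by omega)
  | last h => exact .last (by omega)

/-- Conditions satisfied by four consecutive contents of a chain of Young diagrams. -/
def ContentQuad (a b c d : ℤ) : Prop :=
  a ≠ b ∧ b ≠ c ∧ c ≠ d ∧ a ≠ c ∧ b ≠ d ∧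
    (a = d → (b = a + 1 ∧ c = a - 1) ∨ (b = a - 1 ∧ c = a + 1))

theorem ElemTriple.shuffle_right {t t' : List ℤ} (h : ElemTriple t t') {d : ℤ}
    (hd : ∀ a b c, t = [a, b, c] → ContentQuad a b c d) :
    ∃ e s s', wordShuffle t [d] = ([e], s) ∧ wordShuffle t' [d] = ([e], s') ∧
      ElemTriple s s' := by
  cases h with
  | @first a b c h =>
    obtain ⟨h1, h2, h3, h4, h5, h6⟩ := hd _ _ _ rfl
    obtain ⟨x1, y1, e1, k1⟩ := contentSwap_cases c d
    obtain ⟨x2, y2, e2, k2⟩ := contentSwap_cases b x1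
    obtain ⟨x3, y3, e3, k3⟩ := contentSwap_cases a x2
    obtain ⟨x4, y4, e4, k4⟩ := contentSwap_cases b d
    obtain ⟨x5, y5, e5, k5⟩ := contentSwap_cases c x4
    obtain ⟨x6, y6, e6, k6⟩ := contentSwap_cases a x5
    simp only [wordShuffle, slideLetter, e1, e2, e3, e4, e5, e6]
    rcases k1 with ⟨k1, rfl, rfl⟩ | ⟨k1, rfl, rfl⟩
    all_goals rcases k2 with ⟨k2, rfl, rfl⟩ | ⟨k2, rfl, rfl⟩
    all_goals try (exfalso; omega)
    all_goals rcases k3 with ⟨k3, rfl, rfl⟩ | ⟨k3, rfl, rfl⟩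
    all_goals rcases k4 with ⟨k4, rfl, rfl⟩ | ⟨k4, rfl, rfl⟩
    all_goals try (exfalso; omega)
    all_goals rcases k5 with ⟨k5, rfl, rfl⟩ | ⟨k5, rfl, rfl⟩
    all_goals try (exfalso; omega)
    all_goals rcases k6 with ⟨k6, rfl, rfl⟩ | ⟨k6, rfl, rfl⟩
    all_goals try (exfalso; omega)
    all_goals first
      | exact ⟨_, _, _, rfl, rfl, .first (by omega)⟩
      | exact ⟨_, _, _, rfl, rfl, .last (by omega)⟩
  | @last a b c h =>
    obtain ⟨h1, h2, h3, h4, h5, h6⟩ := hd _ _ _ rfl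
    obtain ⟨x1, y1, e1, k1⟩ := contentSwap_cases c d
    obtain ⟨x2, y2, e2, k2⟩ := contentSwap_cases b x1
    obtain ⟨x3, y3, e3, k3⟩ := contentSwap_cases a x2
    obtain ⟨x4, y4, e4, k4⟩ := contentSwap_cases a x1
    obtain ⟨x5, y5, e5, k5⟩ := contentSwap_cases b x4
    simp only [wordShuffle, slideLetter, e1, e2, e3, e4, e5]
    rcases k1 with ⟨k1, rfl, rfl⟩ | ⟨k1, rfl, rfl⟩
    all_goals rcases k2 with ⟨k2, rfl, rfl⟩ | ⟨k2, rfl, rfl⟩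
    all_goals rcases k3 with ⟨k3, rfl, rfl⟩ | ⟨k3, rfl, rfl⟩
    all_goals try (exfalso; omega)
    all_goals rcases k4 with ⟨k4, rfl, rfl⟩ | ⟨k4, rfl, rfl⟩
    all_goals try (exfalso; omega)
    all_goals rcases k5 with ⟨k5, rfl, rfl⟩ | ⟨k5, rfl, rfl⟩
    all_goals try (exfalso; omega)
    all_goals first
      | exact ⟨_, _, _, rfl, rfl, .first (by omega)⟩
      | exact ⟨_, _, _, rfl, rfl, .last (by omega)⟩

theorem ElemTriple.shuffle_left {t t' : List ℤ} (h : ElemTriple t t') {d : ℤ}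
    (hd : ∀ a b c, t = [a, b, c] → ContentQuad d a b c) :
    ∃ e s s', wordShuffle [d] t = (s, [e]) ∧ wordShuffle [d] t' = (s', [e]) ∧
      ElemTriple s s' := by
  cases h with
  | @first a b c h =>
    obtain ⟨h1, h2, h3, h4, h5, h6⟩ := hd _ _ _ rfl
    obtain ⟨x1, y1, e1, k1⟩ := contentSwap_cases d a
    obtain ⟨x2, y2, e2, k2⟩ := contentSwap_cases y1 b
    obtain ⟨x3, y3, e3, k3⟩ := contentSwap_cases y2 c
    obtain ⟨x4, y4, e4, k4⟩ := contentSwap_cases y1 c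
    obtain ⟨x5, y5, e5, k5⟩ := contentSwap_cases y4 b
    simp only [wordShuffle, slideLetter, e1, e2, e3, e4, e5]
    rcases k1 with ⟨k1, rfl, rfl⟩ | ⟨k1, rfl, rfl⟩
    all_goals rcases k2 with ⟨k2, rfl, rfl⟩ | ⟨k2, rfl, rfl⟩
    all_goals rcases k3 with ⟨k3, rfl, rfl⟩ | ⟨k3, rfl, rfl⟩
    all_goals try (exfalso; omega)
    all_goals rcases k4 with ⟨k4, rfl, rfl⟩ | ⟨k4, rfl, rfl⟩
    all_goals try (exfalso; omega)
    all_goals rcases k5 with ⟨k5, rfl, rfl⟩ | ⟨k5, rfl, rfl⟩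
    all_goals try (exfalso; omega)
    all_goals first
      | exact ⟨_, _, _, rfl, rfl, .first (by omega)⟩
  | @last a b c h =>
    obtain ⟨h1, h2, h3, h4, h5, h6⟩ := hd _ _ _ rfl
    obtain ⟨x1, y1, e1, k1⟩ := contentSwap_cases d a
    obtain ⟨x2, y2, e2, k2⟩ := contentSwap_cases y1 b
    obtain ⟨x3, y3, e3, k3⟩ := contentSwap_cases y2 c
    obtain ⟨x4, y4, e4, k4⟩ := contentSwap_cases d b
    obtain ⟨x5, y5, e5, k5⟩ := contentSwap_cases y4 a
    obtain ⟨x6, y6, e6, k6⟩ := contentSwap_cases y5 c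
    simp only [wordShuffle, slideLetter, e1, e2, e3, e4, e5, e6]
    rcases k1 with ⟨k1, rfl, rfl⟩ | ⟨k1, rfl, rfl⟩
    all_goals rcases k2 with ⟨k2, rfl, rfl⟩ | ⟨k2, rfl, rfl⟩
    all_goals try (exfalso; omega)
    all_goals rcases k3 with ⟨k3, rfl, rfl⟩ | ⟨k3, rfl, rfl⟩
    all_goals rcases k4 with ⟨k4, rfl, rfl⟩ | ⟨k4, rfl, rfl⟩
    all_goals try (exfalso; omega)
    all_goals rcases k5 with ⟨k5, rfl, rfl⟩ | ⟨k5, rfl, rfl⟩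
    all_goals try (exfalso; omega)
    all_goals rcases k6 with ⟨k6, rfl, rfl⟩ | ⟨k6, rfl, rfl⟩
    all_goals try (exfalso; omega)
    all_goals first
      | exact ⟨_, _, _, rfl, rfl, .first (by omega)⟩
      | exact ⟨_, _, _, rfl, rfl, .last (by omega)⟩

/-- `ν` is obtained from `μ` by adding one box of content `c`. -/
def AddContent (μ : YoungDiagram) (c : ℤ) (ν : YoungDiagram) : Prop :=
  ∃ i j : ℕ, (i, j) ∉ μ ∧ (∀ p q, (p, q) ∈ ν ↔ (p = i ∧ q = j) ∨ (p, q) ∈ μ) ∧ (j : ℤ) - i = c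

/-- The sum of the contents of the cells of `ν` outside `μ`. -/
def contentDiff (μ ν : YoungDiagram) : ℤ := ∑ x ∈ ν.cells \ μ.cells, ((x.2 : ℤ) - x.1)

theorem YoungDiagram.ext_mem {μ ν : YoungDiagram} (h : ∀ p q, (p, q) ∈ μ ↔ (p, q) ∈ ν) :
    μ = ν :=
  SetLike.ext fun ⟨p, q⟩ => h p q

theorem AddContent.cells_sdiff {μ ν : YoungDiagram} {i j : ℕ} (hx : (i, j) ∉ μ)
    (hν : ∀ p q, (p, q) ∈ ν ↔ (p = i ∧ q = j) ∨ (p, q) ∈ μ) : ν.cells \ μ.cells = {(i, j)} := by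
  ext ⟨p, q⟩
  simp only [Finset.mem_sdiff, YoungDiagram.mem_cells, hν, Finset.mem_singleton, Prod.mk.injEq]
  constructor
  · tauto
  · rintro ⟨rfl, rfl⟩
    exact ⟨.inl ⟨rfl, rfl⟩, hx⟩

theorem AddContent.le {μ ν : YoungDiagram} {c : ℤ} (h : AddContent μ c ν) : μ ≤ ν := by
  obtain ⟨i, j, hx, hν, -⟩ := h
  intro ⟨p, q⟩ hp
  exact (hν p q).2 (.inr hp)

theorem AddContent.card_eq {μ ν : YoungDiagram} {c : ℤ} (h : AddContent μ c ν) :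
    ν.card = μ.card + 1 := by
  have hle := YoungDiagram.cells_subset_iff.2 h.le
  obtain ⟨i, j, hx, hν, -⟩ := h
  have := Finset.card_sdiff_add_card_eq_card hle
  rw [AddContent.cells_sdiff hx hν, Finset.card_singleton] at this
  simp only [YoungDiagram.card]
  omega

theorem AddContent.addBox {μ ν : YoungDiagram} {c : ℤ} (h : AddContent μ c ν) : AddBox μ ν :=
  ⟨h.le, h.card_eq⟩

theorem AddContent.contentDiff_eq {μ ν : YoungDiagram} {c : ℤ} (h : AddContent μ c ν) :
    contentDiff μ ν = c := by
  obtain ⟨i, j, hx, hν, rfl⟩ := h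
  rw [contentDiff, AddContent.cells_sdiff hx hν, Finset.sum_singleton]

theorem AddBox.addContent_s13 {μ ν : YoungDiagram} (h : AddBox μ ν) :
    AddContent μ (contentDiff μ ν) ν := by
  obtain ⟨hle, hc⟩ := h
  have hsub := YoungDiagram.cells_subset_iff.2 hle
  have h1 := Finset.card_sdiff_add_card_eq_card hsub
  simp only [YoungDiagram.card] at hc
  obtain ⟨⟨i, j⟩, hij⟩ := Finset.card_eq_one.1 (show (ν.cells \ μ.cells).card = 1 by omega)
  have hmem : ∀ p q, (p, q) ∈ ν ∧ (p, q) ∉ μ ↔ p = i ∧ q = j := by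
    intro p q
    have : (p, q) ∈ ν.cells \ μ.cells ↔ (p, q) ∈ ({(i, j)} : Finset (ℕ × ℕ)) := by rw [hij]
    simpa using this
  refine ⟨i, j, ((hmem i j).2 ⟨rfl, rfl⟩).2, fun p q => ?_, ?_⟩
  · have := hmem p q
    have h2 : (p, q) ∈ μ → (p, q) ∈ ν := fun h => hle h
    tauto
  · simp [contentDiff, hij]

/-- The cells of a skew shape on one diagonal directly following a lower set are determined. -/
theorem AddContent.right_unique {μ ν ν' : YoungDiagram} {c : ℤ} (h : AddContent μ c ν)
    (h' : AddContent μ c ν') : ν = ν' := by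
  obtain ⟨i, j, hx, hν, rfl⟩ := h
  obtain ⟨i', j', hx', hν', hc⟩ := h'
  have key : i = i' := by
    rcases lt_trichotomy i i' with hlt | h | hlt
    · have h1 := ν'.up_left_mem (show i ≤ i' by omega) (show j ≤ j' by omega)
        ((hν' _ _).2 (.inl ⟨rfl, rfl⟩))
      rcases (hν' _ _).1 h1 with h2 | h2
      · omega
      · exact absurd h2 hx
    · exact h
    · have h1 := ν.up_left_mem (show i' ≤ i by omega) (show j' ≤ j by omega)
        ((hν _ _).2 (.inl ⟨rfl, rfl⟩))
      rcases (hν _ _).1 h1 with h2 | h2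
      · omega
      · exact absurd h2 hx'
  obtain rfl : j = j' := by omega
  subst key
  exact YoungDiagram.ext_mem fun p q => by rw [hν, hν']

theorem AddContent.left_unique {μ μ' ν : YoungDiagram} {c : ℤ} (h : AddContent μ c ν)
    (h' : AddContent μ' c ν) : μ = μ' := by
  obtain ⟨i, j, hx, hν, rfl⟩ := h
  obtain ⟨i', j', hx', hν', hc⟩ := h'
  have key : i = i' := by
    rcases lt_trichotomy i i' with hlt | h | hlt
    · rcases (hν i' j').1 ((hν' _ _).2 (.inl ⟨rfl, rfl⟩)) with h2 | h2
      · omega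
      · exact absurd (μ.up_left_mem (show i ≤ i' by omega) (show j ≤ j' by omega) h2) hx
    · exact h
    · rcases (hν' i j).1 ((hν _ _).2 (.inl ⟨rfl, rfl⟩)) with h2 | h2
      · omega
      · exact absurd (μ'.up_left_mem (show i' ≤ i by omega) (show j' ≤ j by omega) h2) hx'
  obtain rfl : j = j' := by omega
  subst key
  refine YoungDiagram.ext_mem fun p q => ?_
  have h1 := hν p q
  have h2 := hν' p q
  by_cases hpq : p = i ∧ q = j
  · obtain ⟨rfl, rfl⟩ := hpq
    exact iff_of_false hx hx'
  · tauto

theorem AddContent.ne_of_addContent {μ ν π : YoungDiagram} {a b : ℤ} (h : AddContent μ a ν)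
    (h' : AddContent ν b π) : a ≠ b := by
  obtain ⟨i, j, hx, hν, rfl⟩ := h
  obtain ⟨i', j', hx', hπ, rfl⟩ := h'
  intro hc
  rcases lt_or_ge i i' with hlt | hge
  · have h1 := π.up_left_mem (show i + 1 ≤ i' by omega) (show j ≤ j' by omega)
        ((hπ _ _).2 (.inl ⟨rfl, rfl⟩))
    rcases (hπ _ _).1 h1 with h2 | h2
    · omega
    · rcases (hν _ _).1 h2 with h3 | h3
      · omega
      · exact hx (μ.up_left_mem (by omega) le_rfl h3)
  · exact hx' (ν.up_left_mem (show i' ≤ i by omega) (show j' ≤ j by omega)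
      ((hν _ _).2 (.inl ⟨rfl, rfl⟩)))

/-- A Young diagram obtained by adjoining a cell. -/
def YoungDiagram.insertCell (μ : YoungDiagram) (i j : ℕ)
    (h : ∀ p q, p ≤ i → q ≤ j → (p, q) ≠ (i, j) → (p, q) ∈ μ) : YoungDiagram where
  cells := insert (i, j) μ.cells
  isLowerSet := by
    rintro ⟨p, q⟩ ⟨p', q'⟩ hle hp
    simp only [Finset.coe_insert, Set.mem_insert_iff, Finset.mem_coe,
      YoungDiagram.mem_cells] at hp ⊢
    obtain ⟨h1, h2⟩ := Prod.mk_le_mk.1 hle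
    rcases hp with hp | hp
    · obtain ⟨rfl, rfl⟩ := Prod.mk.inj hp
      by_cases he : (p', q') = (p, q)
      · exact .inl he
      · exact .inr (h _ _ h1 h2 he)
    · exact .inr (μ.up_left_mem h1 h2 hp)

theorem YoungDiagram.mem_insertCell {μ : YoungDiagram} {i j : ℕ}
    {h : ∀ p q, p ≤ i → q ≤ j → (p, q) ≠ (i, j) → (p, q) ∈ μ} (p q : ℕ) :
    (p, q) ∈ μ.insertCell i j h ↔ (p = i ∧ q = j) ∨ (p, q) ∈ μ := by
  rw [← YoungDiagram.mem_cells]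
  simp [YoungDiagram.insertCell]

theorem AddContent.swap {μ ν π : YoungDiagram} {a b : ℤ} (h : AddContent μ a ν)
    (h' : AddContent ν b π) (hab : a + 2 ≤ b ∨ b + 2 ≤ a) :
    ∃ ν', AddContent μ b ν' ∧ AddContent ν' a π := by
  obtain ⟨i, j, hx, hν, rfl⟩ := h
  obtain ⟨i', j', hx', hπ, rfl⟩ := h'
  have hlow : ∀ p q, p ≤ i' → q ≤ j' → (p, q) ≠ (i', j') → (p, q) ∈ μ := by
    intro p q hp hq hne
    have hmem : ∀ p q, p ≤ i' → q ≤ j' → ¬ (p = i' ∧ q = j') → (p, q) ∈ ν := by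
      intro p q hp hq hne
      rcases (hπ _ _).1 (π.up_left_mem hp hq ((hπ _ _).2 (.inl ⟨rfl, rfl⟩))) with h2 | h2
      · exact absurd h2 hne
      · exact h2
    rcases (hν _ _).1 (hmem p q hp hq (by simpa using hne)) with h2 | h2
    · exfalso
      obtain ⟨rfl, rfl⟩ := h2
      by_cases hp' : p < i'
      · by_cases hq' : q < j'
        · rcases (hν _ _).1 (hmem (p + 1) q (by omega) hq (by omega)) with h3 | h3
          · omega
          · exact hx (μ.up_left_mem (by omega) le_rfl h3)
        · rcases (hν _ _).1 (hmem (p + 1) q (by omega) hq (by omega)) with h3 | h3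
          · omega
          · exact hx (μ.up_left_mem (by omega) le_rfl h3)
      · rcases (hν _ _).1 (hmem p (q + 1) hp (by simp at hne; omega) (by omega)) with h3 | h3
        · omega
        · exact hx (μ.up_left_mem le_rfl (by omega) h3)
    · exact h2
  have hne : ¬ (i = i' ∧ j = j') := by omega
  refine ⟨μ.insertCell i' j' hlow, ⟨i', j', fun hm => hx' ((hν _ _).2 (.inr hm)),
    YoungDiagram.mem_insertCell, rfl⟩, ⟨i, j, ?_, fun p q => ?_, rfl⟩⟩
  · rw [YoungDiagram.mem_insertCell]
    tauto
  · rw [YoungDiagram.mem_insertCell, hπ, hν]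
    tauto

theorem AddContent.ne_of_three {μ ν π ρ : YoungDiagram} {a b c : ℤ} (h₁ : AddContent μ a ν)
    (h₂ : AddContent ν b π) (h₃ : AddContent π c ρ) : a ≠ c := by
  rintro rfl
  by_cases hab : a + 2 ≤ b ∨ b + 2 ≤ a
  · obtain ⟨ν', -, h⟩ := h₁.swap h₂ hab
    exact h.ne_of_addContent h₃ rfl
  have hne := h₁.ne_of_addContent h₂
  obtain ⟨i, j, hx, hν, hc⟩ := h₁
  obtain ⟨i', j', hx', hπ, hb⟩ := h₂
  obtain ⟨k, l, hy, hρ, hd⟩ := h₃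
  have hki : i < k := by
    by_contra hle
    exact hy ((hπ _ _).2 (.inr (ν.up_left_mem (show k ≤ i by omega) (show l ≤ j by omega)
      ((hν _ _).2 (.inl ⟨rfl, rfl⟩)))))
  have h1 : (i + 1, j) ∈ ρ :=
    ρ.up_left_mem (by omega) (by omega) ((hρ _ _).2 (.inl ⟨rfl, rfl⟩))
  have h2 : (i, j + 1) ∈ ρ :=
    ρ.up_left_mem (by omega) (by omega) ((hρ _ _).2 (.inl ⟨rfl, rfl⟩))
  have h3 : (i + 1, j) ∉ μ := fun h => hx (μ.up_left_mem (by omega) le_rfl h)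
  have h4 : (i, j + 1) ∉ μ := fun h => hx (μ.up_left_mem le_rfl (by omega) h)
  rw [hρ, hπ, hν] at h1 h2
  rcases h1 with h1 | h1 | h1 | h1 <;> rcases h2 with h2 | h2 | h2 | h2 <;>
    first | omega | contradiction

theorem AddContent.contentQuad {κ₀ κ₁ κ₂ κ₃ κ₄ : YoungDiagram} {a b c d : ℤ}
    (h₁ : AddContent κ₀ a κ₁) (h₂ : AddContent κ₁ b κ₂) (h₃ : AddContent κ₂ c κ₃)
    (h₄ : AddContent κ₃ d κ₄) : ContentQuad a b c d := by
  refine ⟨h₁.ne_of_addContent h₂, h₂.ne_of_addContent h₃, h₃.ne_of_addContent h₄,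
    h₁.ne_of_three h₂ h₃, h₂.ne_of_three h₃ h₄, ?_⟩
  rintro rfl
  have hbc := h₂.ne_of_addContent h₃
  have hab := h₁.ne_of_addContent h₂
  have hca := h₃.ne_of_addContent h₄
  have h5 : ¬ (a + 2 ≤ b ∨ b + 2 ≤ a) := by
    intro h
    obtain ⟨ν, -, h'⟩ := h₁.swap h₂ h
    exact h'.ne_of_three h₃ h₄ rfl
  have h6 : ¬ (c + 2 ≤ a ∨ a + 2 ≤ c) := by
    intro h
    obtain ⟨ν, h', -⟩ := h₃.swap h₄ h
    exact h₁.ne_of_three h₂ h' rfl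
  omega

/-- The local rule for the four corners of a unit square of a growth diagram. -/
def LocalRule (a b b' c : YoungDiagram) : Prop :=
  (∃ c₁ ∈ c.cells \ a.cells, ∃ c₂ ∈ c.cells \ a.cells, c₁ ≠ c₂ ∧ ¬ CellAdj c₁ c₂) → b ≠ b'

/-- Consecutive boxes are nonadjacent exactly when their contents differ by at least two. -/
theorem AddContent.exists_nonadj_iff {μ ν π : YoungDiagram} {a b : ℤ} (h : AddContent μ a ν)
    (h' : AddContent ν b π) :
    (∃ c₁ ∈ π.cells \ μ.cells, ∃ c₂ ∈ π.cells \ μ.cells, c₁ ≠ c₂ ∧ ¬ CellAdj c₁ c₂) ↔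
      (a + 2 ≤ b ∨ b + 2 ≤ a) := by
  have hne := h.ne_of_addContent h'
  obtain ⟨i, j, hx, hν, rfl⟩ := h
  obtain ⟨i', j', hx', hπ, rfl⟩ := h'
  have hmem : ∀ p q, (p, q) ∈ π.cells \ μ.cells ↔ (p = i ∧ q = j) ∨ (p = i' ∧ q = j') := by
    intro p q
    simp only [Finset.mem_sdiff, YoungDiagram.mem_cells, hπ, hν]
    have h1 : p = i ∧ q = j → (p, q) ∉ μ := by rintro ⟨rfl, rfl⟩; exact hx
    have h2 : p = i' ∧ q = j' → (p, q) ∉ μ := by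
      rintro ⟨rfl, rfl⟩ h
      exact hx' ((hν _ _).2 (.inr h))
    tauto
  constructor
  · rintro ⟨⟨p, q⟩, hp, ⟨r, s⟩, hr, hpr, hadj⟩
    by_contra hfar
    apply hadj
    rw [hmem] at hp hr
    have key : |(i : ℤ) - i'| + |(j : ℤ) - j'| = 1 := by
      by_cases h1 : i' ≤ i ∧ j' ≤ j
      · exact absurd (ν.up_left_mem h1.1 h1.2 ((hν _ _).2 (.inl ⟨rfl, rfl⟩))) hx'
      by_cases h2 : i < i' ∧ j < j' ∨ i + 1 < i' ∨ j + 1 < j'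
      · exfalso
        have h3 : (i' = i ∨ (i + 1, j) ∈ π) ∧ (j' = j ∨ (i, j + 1) ∈ π) := by
          constructor
          · by_cases h : i' = i
            · exact .inl h
            · exact .inr (π.up_left_mem (by omega) (by omega) ((hπ _ _).2 (.inl ⟨rfl, rfl⟩)))
          · by_cases h : j' = j
            · exact .inl h
            · exact .inr (π.up_left_mem (by omega) (by omega) ((hπ _ _).2 (.inl ⟨rfl, rfl⟩)))
        have h4 : (i + 1, j) ∉ μ := fun h => hx (μ.up_left_mem (by omega) le_rfl h)
        have h5 : (i, j + 1) ∉ μ := fun h => hx (μ.up_left_mem le_rfl (by omega) h)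
        simp only [hπ, hν, h4, h5, or_false, and_true] at h3
        omega
      · have : (i' = i ∧ j' = j + 1) ∨ (i' = i + 1 ∧ j' = j) := by omega
        rcases this with ⟨rfl, rfl⟩ | ⟨rfl, rfl⟩ <;> simp
    simp only [ne_eq, Prod.mk.injEq] at hpr
    simp only [CellAdj]
    rcases hp with ⟨rfl, rfl⟩ | ⟨rfl, rfl⟩ <;> rcases hr with ⟨rfl, rfl⟩ | ⟨rfl, rfl⟩
    · tauto
    · exact key
    · rw [abs_sub_comm, abs_sub_comm (q : ℤ)]; exact key
    · tauto
  · intro hfar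
    refine ⟨(i, j), (hmem _ _).2 (.inl ⟨rfl, rfl⟩), (i', j'), (hmem _ _).2 (.inr ⟨rfl, rfl⟩),
      ?_, ?_⟩
    · simp only [ne_eq, Prod.mk.injEq]; omega
    · simp only [CellAdj]
      intro h
      rcases abs_cases ((i : ℤ) - i') with h1 | h1 <;>
        rcases abs_cases ((j : ℤ) - j') with h2 | h2 <;> omega

theorem AddContent.eq_contentSwap {μ ν ν' π : YoungDiagram} {a b a' b' : ℤ}
    (h₁ : AddContent μ a ν) (h₂ : AddContent ν b π) (h₃ : AddContent μ b' ν')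
    (h₄ : AddContent ν' a' π) (hloc : LocalRule μ ν ν' π) : contentSwap a b = (b', a') := by
  have hadj := h₁.exists_nonadj_iff h₂
  have hmulti : (b' = a ∧ a' = b) ∨ (b' = b ∧ a' = a) := by
    obtain ⟨i, j, hx, hν, rfl⟩ := h₁
    obtain ⟨i', j', hx', hπ, rfl⟩ := h₂
    obtain ⟨k, l, hy, hν', rfl⟩ := h₃
    obtain ⟨k', l', hy', hπ', rfl⟩ := h₄
    have e : ∀ p q, ((p = i' ∧ q = j') ∨ (p = i ∧ q = j) ∨ (p, q) ∈ μ) ↔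
        ((p = k' ∧ q = l') ∨ (p = k ∧ q = l) ∨ (p, q) ∈ μ) := by
      intro p q
      rw [← hν, ← hπ, ← hν', ← hπ']
    have hx'' : (i', j') ∉ μ ∧ ¬ (i' = i ∧ j' = j) := by
      rw [hν] at hx'; tauto
    have hy'' : (k', l') ∉ μ ∧ ¬ (k' = k ∧ l' = l) := by
      rw [hν'] at hy'; tauto
    have e1 := e i j
    have e2 := e i' j'
    have e3 := e k l
    have e4 := e k' l'
    simp only [hx, hx'', hy, hy'', or_false, and_self, or_true, iff_true, true_iff]
      at e1 e2 e3 e4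
    omega
  unfold contentSwap
  split_ifs with hfar
  · rcases hmulti with ⟨rfl, rfl⟩ | ⟨rfl, rfl⟩
    · exact absurd (h₁.right_unique h₃) (hloc (hadj.2 hfar))
    · rfl
  · rcases hmulti with ⟨rfl, rfl⟩ | ⟨rfl, rfl⟩
    · rfl
    · exfalso
      have hne := h₁.ne_of_addContent h₂
      obtain ⟨i, j, hx, hν, hc⟩ := h₁
      obtain ⟨i', j', hx', hπ, hb⟩ := h₂
      obtain ⟨k, l, hy, hν', hc'⟩ := h₃
      obtain ⟨k', l', hy', hπ', hb'⟩ := h₄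
      have e : (i', j') ∈ π := (hπ _ _).2 (.inl ⟨rfl, rfl⟩)
      have e' : (i, j) ∈ π := (hπ _ _).2 (.inr ((hν _ _).2 (.inl ⟨rfl, rfl⟩)))
      have e2 : ¬ ((i', j') ∈ μ) := fun h => hx' ((hν _ _).2 (.inr h))
      rw [hπ', hν'] at e e'
      have f : i' = k ∧ j' = l := by
        rcases e with e | e | e
        · omega
        · exact e
        · contradiction
      have hkl : (k, l) ∈ ν' := (hν' _ _).2 (.inl ⟨rfl, rfl⟩)
      have hij : (i, j) ∈ ν := (hν _ _).2 (.inl ⟨rfl, rfl⟩)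
      obtain ⟨rfl, rfl⟩ := f
      have h1 : ¬ (i' ≤ i ∧ j' ≤ j) := fun h => hx' (ν.up_left_mem h.1 h.2 hij)
      have h2 : ¬ (i ≤ i' ∧ j ≤ j') := by
        intro h
        rcases (hν' _ _).1 (ν'.up_left_mem h.1 h.2 hkl) with h | h
        · omega
        · contradiction
      omega

theorem AddBox.exists_localRule {μ ν π : YoungDiagram} (h : AddBox μ ν) (h' : AddBox ν π) :
    ∃ ν', AddBox μ ν' ∧ AddBox ν' π ∧ LocalRule μ ν ν' π := by
  have h₁ := h.addContent_s13
  have h₂ := h'.addContent_s13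
  by_cases hfar : contentDiff μ ν + 2 ≤ contentDiff ν π ∨ contentDiff ν π + 2 ≤ contentDiff μ ν
  · obtain ⟨ν', h₃, h₄⟩ := h₁.swap h₂ hfar
    refine ⟨ν', h₃.addBox, h₄.addBox, ?_⟩
    rintro - rfl
    exact h₁.ne_of_addContent h₂ h₃.contentDiff_eq
  · exact ⟨ν, h, h', fun hn => absurd ((h₁.exists_nonadj_iff h₂).1 hn) hfar⟩

/-- The word `w` lists the contents of the boxes added along a chain from `μ` to `ν`. -/
def ContentPath : YoungDiagram → List ℤ → YoungDiagram → Prop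
  | μ, [], ν => μ = ν
  | μ, c :: w, ν => ∃ κ, AddContent μ c κ ∧ ContentPath κ w ν

theorem contentPath_nil {μ ν : YoungDiagram} : ContentPath μ [] ν ↔ μ = ν := Iff.rfl

theorem contentPath_cons {μ ν : YoungDiagram} {c : ℤ} {w : List ℤ} :
    ContentPath μ (c :: w) ν ↔ ∃ κ, AddContent μ c κ ∧ ContentPath κ w ν := Iff.rfl

theorem contentPath_singleton {μ ν : YoungDiagram} {c : ℤ} :
    ContentPath μ [c] ν ↔ AddContent μ c ν := by
  simp [contentPath_cons, contentPath_nil]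

theorem contentPath_append {μ ν : YoungDiagram} {u v : List ℤ} :
    ContentPath μ (u ++ v) ν ↔ ∃ κ, ContentPath μ u κ ∧ ContentPath κ v ν := by
  induction u generalizing μ with
  | nil => simp [contentPath_nil]
  | cons c u ih =>
    simp only [List.cons_append, contentPath_cons, ih]
    constructor
    · rintro ⟨κ, h, κ', h₁, h₂⟩
      exact ⟨κ', ⟨κ, h, h₁⟩, h₂⟩
    · rintro ⟨κ', ⟨κ, h, h₁⟩, h₂⟩
      exact ⟨κ, h, κ', h₁, h₂⟩

theorem ContentPath.append {μ ν π : YoungDiagram} {u v : List ℤ} (hu : ContentPath μ u ν)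
    (hv : ContentPath ν v π) : ContentPath μ (u ++ v) π :=
  contentPath_append.2 ⟨ν, hu, hv⟩

theorem ContentPath.right_unique {μ ν ν' : YoungDiagram} {w : List ℤ} (h : ContentPath μ w ν)
    (h' : ContentPath μ w ν') : ν = ν' := by
  induction w generalizing μ with
  | nil => exact h.symm.trans h'
  | cons c w ih =>
    obtain ⟨κ, h₁, h₂⟩ := h
    obtain ⟨κ', h₁', h₂'⟩ := h'
    obtain rfl := h₁.right_unique h₁'
    exact ih h₂ h₂'

theorem ContentPath.left_unique {μ μ' ν : YoungDiagram} {w : List ℤ} (h : ContentPath μ w ν)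
    (h' : ContentPath μ' w ν) : μ = μ' := by
  induction w generalizing μ μ' with
  | nil => exact h.trans h'.symm
  | cons c w ih =>
    obtain ⟨κ, h₁, h₂⟩ := h
    obtain ⟨κ', h₁', h₂'⟩ := h'
    obtain rfl := ih h₂ h₂'
    exact h₁.left_unique h₁'

theorem ContentPath.le {μ ν : YoungDiagram} {w : List ℤ} (h : ContentPath μ w ν) : μ ≤ ν := by
  induction w generalizing μ with
  | nil => exact (contentPath_nil.1 h).le
  | cons c w ih =>
    obtain ⟨κ, h₁, h₂⟩ := h
    exact h₁.le.trans (ih h₂)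

theorem ContentPath.card_eq {μ ν : YoungDiagram} {w : List ℤ} (h : ContentPath μ w ν) :
    ν.card = μ.card + w.length := by
  induction w generalizing μ with
  | nil => simp [contentPath_nil.1 h]
  | cons c w ih =>
    obtain ⟨κ, h₁, h₂⟩ := h
    rw [ih h₂, h₁.card_eq, List.length_cons]
    omega

theorem AddContent.exists_contentSwap {μ ν π : YoungDiagram} {a b : ℤ} (h : AddContent μ a ν)
    (h' : AddContent ν b π) :
    ∃ ν', AddContent μ (contentSwap a b).1 ν' ∧ AddContent ν' (contentSwap a b).2 π := by
  unfold contentSwap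
  split_ifs with hfar
  · exact h.swap h' hfar
  · exact ⟨ν, h, h'⟩

theorem ContentPath.slideLetter {μ ν π : YoungDiagram} {u : List ℤ} {c : ℤ}
    (h : ContentPath μ u ν) (h' : AddContent ν c π) :
    ∃ ν', AddContent μ (slideLetter u c).1 ν' ∧ ContentPath ν' (slideLetter u c).2 π := by
  induction u generalizing μ with
  | nil =>
    obtain rfl := contentPath_nil.1 h
    exact ⟨π, h', rfl⟩
  | cons a u ih =>
    obtain ⟨κ, h₁, h₂⟩ := h
    obtain ⟨κ', h₃, h₄⟩ := ih h₂
    obtain ⟨ν', h₅, h₆⟩ := h₁.exists_contentSwap h₃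
    exact ⟨ν', h₅, κ', h₆, h₄⟩

theorem ContentPath.wordShuffle {μ ν π : YoungDiagram} {u v : List ℤ} (hu : ContentPath μ u ν)
    (hv : ContentPath ν v π) :
    ∃ ν', ContentPath μ (wordShuffle u v).1 ν' ∧ ContentPath ν' (wordShuffle u v).2 π := by
  induction v generalizing u μ ν with
  | nil =>
    obtain rfl := contentPath_nil.1 hv
    exact ⟨μ, by simp [contentPath_nil], by simpa using hu⟩
  | cons c v ih =>
    obtain ⟨κ, h₁, h₂⟩ := hv
    obtain ⟨ν', h₃, h₄⟩ := hu.slideLetter h₁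
    obtain ⟨ρ, h₅, h₆⟩ := ih h₄ h₂
    exact ⟨ρ, ⟨ν', h₃, h₅⟩, h₆⟩

/-- Every cell of a Young diagram lies weakly above and left of a removable corner. -/
theorem YoungDiagram.exists_corner {μ : YoungDiagram} {p q : ℕ} (h : (p, q) ∈ μ) :
    ∃ (i j : ℕ) (κ : YoungDiagram), p ≤ i ∧ q ≤ j ∧ (i, j) ∉ κ ∧
      ∀ r s, (r, s) ∈ μ ↔ (r = i ∧ s = j) ∨ (r, s) ∈ κ := by
  obtain ⟨⟨i, j⟩, hij, hmax⟩ := Finset.exists_max_image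
    (μ.cells.filter fun x => p ≤ x.1 ∧ q ≤ x.2) (fun x => x.1 + x.2)
    ⟨(p, q), by simpa using h⟩
  simp only [Finset.mem_filter, YoungDiagram.mem_cells] at hij hmax
  obtain ⟨hij, hp, hq⟩ := hij
  have hcorner : ∀ r s, (r, s) ∈ μ → i ≤ r → j ≤ s → r = i ∧ s = j := by
    intro r s hrs h1 h2
    have := hmax (r, s) ⟨hrs, by omega, by omega⟩
    simp only at this
    omega
  refine ⟨i, j, ⟨μ.cells.erase (i, j), ?_⟩, hp, hq, ?_, ?_⟩
  · rintro ⟨r, s⟩ ⟨r', s'⟩ hle hrs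
    simp only [Finset.coe_erase, Set.mem_sdiff, Finset.mem_coe, YoungDiagram.mem_cells,
      Set.mem_singleton_iff, Prod.mk.injEq] at hrs ⊢
    obtain ⟨h1, h2⟩ := Prod.mk_le_mk.1 hle
    refine ⟨μ.up_left_mem h1 h2 hrs.1, ?_⟩
    rintro ⟨rfl, rfl⟩
    exact hrs.2 (hcorner _ _ hrs.1 h1 h2)
  · simp [← YoungDiagram.mem_cells]
  · intro r s
    simp only [← YoungDiagram.mem_cells, Finset.mem_erase, ne_eq, Prod.mk.injEq]
    by_cases hrs : r = i ∧ s = j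
    · obtain ⟨rfl, rfl⟩ := hrs
      simpa using hij
    · tauto

theorem exists_contentPath {μ ν : YoungDiagram} (h : μ ≤ ν) : ∃ w, ContentPath μ w ν := by
  obtain ⟨n, hn⟩ : ∃ n, ν.card = n := ⟨_, rfl⟩
  induction n generalizing ν with
  | zero =>
    refine ⟨[], contentPath_nil.2 (le_antisymm h ?_)⟩
    have : ν.cells = ∅ := Finset.card_eq_zero.1 hn
    intro x hx
    rw [← YoungDiagram.mem_cells, this] at hx
    simp at hx
  | succ n ih =>
    by_cases hle : ν ≤ μ
    · exact ⟨[], le_antisymm h hle⟩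
    obtain ⟨⟨p, q⟩, hp, hp'⟩ := SetLike.not_le_iff_exists.1 hle
    obtain ⟨i, j, κ, h1, h2, hx, hν⟩ := YoungDiagram.exists_corner hp
    have hadd : AddContent κ ((j : ℤ) - i) ν := ⟨i, j, hx, hν, rfl⟩
    have hμκ : μ ≤ κ := by
      rintro ⟨r, s⟩ hr
      rcases (hν _ _).1 (h hr) with ⟨rfl, rfl⟩ | h3
      · exact absurd (μ.up_left_mem h1 h2 hr) hp'
      · exact h3
    obtain ⟨w, hw⟩ := ih hμκ (by have := hadd.card_eq; omega)
    exact ⟨w ++ [_], hw.append (contentPath_singleton.2 hadd)⟩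

/-- Elementary dual equivalence of content words. -/
def ElemDual (u u' : List ℤ) : Prop :=
  ∃ p t t' s, u = p ++ (t ++ s) ∧ u' = p ++ (t' ++ s) ∧ ElemTriple t t'

theorem ElemDual.append_right {u u' : List ℤ} (h : ElemDual u u') (v : List ℤ) :
    ElemDual (u ++ v) (u' ++ v) := by
  obtain ⟨p, t, t', s, rfl, rfl, ht⟩ := h
  exact ⟨p, t, t', s ++ v, by simp, by simp, ht⟩

theorem ElemDual.reverse_neg {u u' : List ℤ} (h : ElemDual u u') :
    ElemDual (u.map Neg.neg).reverse (u'.map Neg.neg).reverse := by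
  obtain ⟨p, t, t', s, rfl, rfl, ht⟩ := h
  exact ⟨(s.map Neg.neg).reverse, _, _, (p.map Neg.neg).reverse, by simp, by simp,
    ht.map_neg.reverse⟩

theorem ContentPath.elemTriple {μ ν : YoungDiagram} {t t' : List ℤ} (h : ContentPath μ t ν)
    (ht : ElemTriple t t') : ContentPath μ t' ν := by
  cases ht with
  | first hb =>
    obtain ⟨κ, h₁, κ', h₂, κ'', h₃, rfl⟩ := h
    obtain ⟨ρ, h₄, h₅⟩ := h₂.swap h₃ (by omega)
    exact ⟨κ, h₁, ρ, h₄, κ'', h₅, rfl⟩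
  | last hb =>
    obtain ⟨κ, h₁, κ', h₂, κ'', h₃, rfl⟩ := h
    obtain ⟨ρ, h₄, h₅⟩ := h₁.swap h₂ (by omega)
    exact ⟨ρ, h₄, κ', h₅, κ'', h₃, rfl⟩

theorem ContentPath.elemDual {μ ν : YoungDiagram} {u u' : List ℤ} (h : ContentPath μ u ν)
    (hu : ElemDual u u') : ContentPath μ u' ν := by
  obtain ⟨p, t, t', s, rfl, rfl, ht⟩ := hu
  obtain ⟨κ, h₁, h₂⟩ := contentPath_append.1 h
  obtain ⟨κ', h₂, h₃⟩ := contentPath_append.1 h₂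
  exact h₁.append ((h₂.elemTriple ht).append h₃)

theorem ContentPath.reflTransGen_elemDual {μ ν : YoungDiagram} {u u' : List ℤ}
    (h : ContentPath μ u ν) (hu : Relation.ReflTransGen ElemDual u u') : ContentPath μ u' ν := by
  induction hu with
  | refl => exact h
  | tail _ h₂ ih => exact ih.elemDual h₂

theorem ElemDual.slideLetter {u u' : List ℤ} (hu : ElemDual u u') {μ ν π : YoungDiagram} {c : ℤ}
    (h : ContentPath μ u ν) (hc : AddContent ν c π) :
    (slideLetter u c).1 = (slideLetter u' c).1 ∧
      ElemDual (slideLetter u c).2 (slideLetter u' c).2 := by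
  obtain ⟨p, t, t', s, rfl, rfl, ht⟩ := hu
  obtain ⟨κ, h₁, h₂⟩ := contentPath_append.1 h
  obtain ⟨κ', h₂, h₃⟩ := contentPath_append.1 h₂
  obtain ⟨κ'', h₄, h₅⟩ := h₃.slideLetter hc
  obtain ⟨e, r, r', he, he', hr⟩ := ht.shuffle_right (d := (_root_.slideLetter s c).1) (by
    rintro a b d rfl
    obtain ⟨ρ, g₁, ρ', g₂, ρ'', g₃, rfl⟩ := h₂
    exact g₁.contentQuad g₂ g₃ h₄)
  simp only [wordShuffle, Prod.mk.injEq, List.cons.injEq, and_true] at he he'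
  simp only [slideLetter_append, he, he', true_and]
  exact ⟨_, r, r', _, rfl, rfl, hr⟩

theorem ElemDual.wordShuffle_right {u u' : List ℤ} (hu : ElemDual u u') {μ ν π : YoungDiagram}
    {v : List ℤ} (h : ContentPath μ u ν) (hv : ContentPath ν v π) :
    (wordShuffle u v).1 = (wordShuffle u' v).1 := by
  induction v generalizing u u' μ ν with
  | nil => simp
  | cons c v ih =>
    obtain ⟨κ, h₁, h₂⟩ := hv
    obtain ⟨h₃, h₄⟩ := hu.slideLetter h h₁
    obtain ⟨ν', -, h₅⟩ := h.slideLetter h₁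
    simp only [wordShuffle, h₃, ih h₄ h₅ h₂]

theorem exists_wordShuffle_singleton (c : ℤ) (p : List ℤ) :
    ∃ p' c', wordShuffle [c] p = (p', [c']) := by
  induction p generalizing c with
  | nil => exact ⟨[], c, rfl⟩
  | cons a p ih =>
    obtain ⟨p', c', h⟩ := ih (contentSwap c a).2
    exact ⟨(contentSwap c a).1 :: p', c', by simp [wordShuffle, slideLetter, h]⟩

theorem ElemDual.wordShuffle_singleton {u u' : List ℤ} (hu : ElemDual u u')
    {μ ν π : YoungDiagram} {c : ℤ} (hc : AddContent μ c ν) (h : ContentPath ν u π) :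
    (wordShuffle [c] u).2 = (wordShuffle [c] u').2 ∧
      ElemDual (wordShuffle [c] u).1 (wordShuffle [c] u').1 := by
  obtain ⟨p, t, t', s, rfl, rfl, ht⟩ := hu
  obtain ⟨κ, h₁, h₂⟩ := contentPath_append.1 h
  obtain ⟨κ', h₂, h₃⟩ := contentPath_append.1 h₂
  obtain ⟨p', c', hp⟩ := exists_wordShuffle_singleton c p
  obtain ⟨κ'', -, h₄⟩ := (contentPath_singleton.2 hc).wordShuffle h₁
  rw [hp] at h₄
  obtain ⟨e, r, r', he, he', hr⟩ := ht.shuffle_left (d := c') (by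
    rintro a b d rfl
    obtain ⟨ρ, g₁, ρ', g₂, ρ'', g₃, rfl⟩ := h₂
    exact (contentPath_singleton.1 h₄).contentQuad g₁ g₂ g₃)
  simp only [wordShuffle_append_right, hp, he, he', true_and]
  exact ⟨p', r, r', _, rfl, rfl, hr⟩

theorem ElemDual.wordShuffle_left {u u' : List ℤ} (hu : ElemDual u u') {μ ν π : YoungDiagram}
    {v : List ℤ} (hv : ContentPath μ v ν) (h : ContentPath ν u π) :
    (wordShuffle v u).2 = (wordShuffle v u').2 := by
  induction v using List.reverseRecOn generalizing u u' ν π with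
  | nil => simp
  | append_singleton v c ih =>
    obtain ⟨κ, h₁, h₂⟩ := contentPath_append.1 hv
    obtain ⟨h₃, h₄⟩ := hu.wordShuffle_singleton (contentPath_singleton.1 h₂) h
    obtain ⟨ν', h₅, -⟩ := h₂.wordShuffle h
    simp only [wordShuffle_append_left, h₃, ih h₄ h₁ h₅]

/-- Two tableaux of the same straight shape are linked by elementary dual equivalences. -/
theorem ContentPath.reflTransGen_of_bot {μ : YoungDiagram} {u u' : List ℤ}
    (h : ContentPath ⊥ u μ) (h' : ContentPath ⊥ u' μ) : Relation.ReflTransGen ElemDual u u' := by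
  obtain ⟨n, hn⟩ : ∃ n, μ.card = n := ⟨_, rfl⟩
  induction n generalizing μ u u' with
  | zero =>
    have h1 := h.card_eq
    have h2 := h'.card_eq
    obtain rfl : u = [] := List.length_eq_zero_iff.1 (by omega)
    obtain rfl : u' = [] := List.length_eq_zero_iff.1 (by omega)
    exact .refl
  | succ n ih =>
    have hbot : (⊥ : YoungDiagram).card = 0 := rfl
    have ih' : ∀ {κ : YoungDiagram} {v v' : List ℤ} {c : ℤ}, AddContent κ c μ →
        ContentPath ⊥ v κ → ContentPath ⊥ v' κ →
        Relation.ReflTransGen ElemDual (v ++ [c]) (v' ++ [c]) := by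
      intro κ v v' c hc hv hv'
      have := ih hv hv' (by have := hc.card_eq; omega)
      exact this.lift (· ++ [c]) fun _ _ h => h.append_right [c]
    rcases List.eq_nil_or_concat' u with rfl | ⟨v, c, rfl⟩
    · have := h.card_eq; simp at this; omega
    rcases List.eq_nil_or_concat' u' with rfl | ⟨v', c', rfl⟩
    · have := h'.card_eq; simp at this; omega
    obtain ⟨κ, hv, hc⟩ := contentPath_append.1 h
    obtain ⟨κ', hv', hc'⟩ := contentPath_append.1 h'
    rw [contentPath_singleton] at hc hc'
    by_cases hcc : c = c'
    · subst hcc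
      obtain rfl := hc.left_unique hc'
      exact ih' hc hv hv'
    obtain ⟨i, j, hx, hμ, hij⟩ := hc
    obtain ⟨i', j', hx', hμ', hij'⟩ := hc'
    have hκκ : ∀ p q, (p = i ∧ q = j) ∨ (p, q) ∈ κ ↔ (p = i' ∧ q = j') ∨ (p, q) ∈ κ' :=
      fun p q => by rw [← hμ, ← hμ']
    have hne : ¬ (i = i' ∧ j = j') := by omega
    have hx₁ : (i', j') ∈ κ := by have := hκκ i' j'; tauto
    have hx₂ : (i, j) ∈ κ' := by have := hκκ i j; tauto
    have hinf : ∀ p q, (p, q) ∈ κ ⊓ κ' ↔ (p, q) ∈ κ ∧ (p, q) ∈ κ' := fun p q =>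
      YoungDiagram.mem_inf
    have e : ∀ p q, (p, q) ∈ κ ↔ (p = i' ∧ q = j') ∨ (p, q) ∈ κ ⊓ κ' := by
      intro p q
      rw [hinf]
      have h1 := hκκ p q
      have h2 : p = i' ∧ q = j' → (p, q) ∈ κ := by rintro ⟨rfl, rfl⟩; exact hx₁
      tauto
    have e' : ∀ p q, (p, q) ∈ κ' ↔ (p = i ∧ q = j) ∨ (p, q) ∈ κ ⊓ κ' := by
      intro p q
      rw [hinf]
      have h1 := hκκ p q
      have h2 : p = i ∧ q = j → (p, q) ∈ κ' := by rintro ⟨rfl, rfl⟩; exact hx₂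
      tauto
    have hκ : AddContent (κ ⊓ κ') c' κ := ⟨i', j', fun h => hx' ((hinf _ _).1 h).2, e, hij'⟩
    have hκ' : AddContent (κ ⊓ κ') c κ' := ⟨i, j, fun h => hx ((hinf _ _).1 h).1, e', hij⟩
    have hnle : ¬ (i' ≤ i ∧ j' ≤ j) := fun h => hx' (κ'.up_left_mem h.1 h.2 hx₂)
    have hnle' : ¬ (i ≤ i' ∧ j ≤ j') := fun h => hx (κ.up_left_mem h.1 h.2 hx₁)
    have hmin : (min i i', min j j') ∈ κ ⊓ κ' :=
      (hinf _ _).2 ⟨κ.up_left_mem (min_le_right _ _) (min_le_right _ _) hx₁,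
        κ'.up_left_mem (min_le_left _ _) (min_le_left _ _) hx₂⟩
    obtain ⟨k, l, ρ, hk, hl, hkl, hρ⟩ := YoungDiagram.exists_corner hmin
    have hmem := (hinf k l).1 ((hρ k l).2 (.inl ⟨rfl, rfl⟩))
    have g : ¬ (i ≤ k ∧ j ≤ l) := fun h => hx (κ.up_left_mem h.1 h.2 hmem.1)
    have g' : ¬ (i' ≤ k ∧ j' ≤ l) := fun h => hx' (κ'.up_left_mem h.1 h.2 hmem.2)
    have hρ' : AddContent ρ ((l : ℤ) - k) (κ ⊓ κ') := ⟨k, l, hkl, hρ, rfl⟩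
    obtain ⟨w, hw⟩ := exists_contentPath (bot_le : ⊥ ≤ ρ)
    have hmid : ElemDual ((w ++ [(l : ℤ) - k, c']) ++ [c]) ((w ++ [(l : ℤ) - k, c]) ++ [c']) :=
      ⟨w, [(l : ℤ) - k, c', c], [(l : ℤ) - k, c, c'], [], by simp, by simp, .first (by omega)⟩
    have hw₁ := hw.append (contentPath_cons.2 ⟨_, hρ', contentPath_singleton.2 hκ⟩)
    have hw₂ := hw.append (contentPath_cons.2 ⟨_, hρ', contentPath_singleton.2 hκ'⟩)
    exact (ih' ⟨i, j, hx, hμ, hij⟩ hv hw₁).trans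
      (.head hmid (ih' ⟨i', j', hx', hμ', hij'⟩ hw₂ hv'))

/-- The first component of the shuffle of a straight-shape tableau with a fixed second tableau
depends only on the shape. -/
theorem ContentPath.wordShuffle_fst_eq {μ ν : YoungDiagram} {u u' v : List ℤ}
    (h : ContentPath ⊥ u μ) (h' : ContentPath ⊥ u' μ) (hv : ContentPath μ v ν) :
    (_root_.wordShuffle u v).1 = (_root_.wordShuffle u' v).1 := by
  induction h.reflTransGen_of_bot h' with
  | refl => rfl
  | tail h₁ h₂ ih =>
    have := h.reflTransGen_elemDual h₁
    exact (ih this).trans (h₂.wordShuffle_right this hv)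

/-- The `N × N` square Young diagram. -/
def squareDiagram (N : ℕ) : YoungDiagram where
  cells := Finset.range N ×ˢ Finset.range N
  isLowerSet := by
    rintro ⟨r, s⟩ ⟨r', s'⟩ hle hrs
    simp only [Finset.coe_product, Finset.coe_range, Set.mem_prod, Set.mem_Iio] at hrs ⊢
    obtain ⟨h1, h2⟩ := Prod.mk_le_mk.1 hle
    omega

theorem mem_squareDiagram {N p q : ℕ} : (p, q) ∈ squareDiagram N ↔ p < N ∧ q < N := by
  simp [← YoungDiagram.mem_cells, squareDiagram]

theorem exists_le_squareDiagram (μ : YoungDiagram) : ∃ N, μ ≤ squareDiagram N := by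
  refine ⟨μ.cells.sup (fun x => x.1 + x.2) + 1, ?_⟩
  rintro ⟨p, q⟩ hp
  have := Finset.le_sup (f := fun x : ℕ × ℕ => x.1 + x.2) (YoungDiagram.mem_cells _ |>.2 hp)
  rw [mem_squareDiagram]
  simp only at this
  omega

/-- The complement of a Young diagram in the `N × N` square, rotated by a half turn. -/
def YoungDiagram.rotCompl (N : ℕ) (μ : YoungDiagram) : YoungDiagram where
  cells := (squareDiagram N).cells.filter fun x => (N - 1 - x.1, N - 1 - x.2) ∉ μ
  isLowerSet := by
    rintro ⟨r, s⟩ ⟨r', s'⟩ hle hrs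
    simp only [Finset.coe_filter, YoungDiagram.mem_cells, Set.mem_ofPred_eq,
      mem_squareDiagram] at hrs ⊢
    obtain ⟨h1, h2⟩ := Prod.mk_le_mk.1 hle
    exact ⟨by omega, fun h => hrs.2 (μ.up_left_mem (by omega) (by omega) h)⟩

theorem YoungDiagram.mem_rotCompl {N : ℕ} {μ : YoungDiagram} {p q : ℕ} :
    (p, q) ∈ μ.rotCompl N ↔ (p < N ∧ q < N) ∧ (N - 1 - p, N - 1 - q) ∉ μ := by
  simp [← YoungDiagram.mem_cells, YoungDiagram.rotCompl, squareDiagram]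

theorem AddContent.rotCompl {N : ℕ} {μ ν : YoungDiagram} {c : ℤ} (h : AddContent μ c ν)
    (hN : ν ≤ squareDiagram N) : AddContent (ν.rotCompl N) (-c) (μ.rotCompl N) := by
  obtain ⟨i, j, hx, hν, rfl⟩ := h
  have hij := mem_squareDiagram.1 (hN ((hν _ _).2 (.inl ⟨rfl, rfl⟩)))
  have hi : N - 1 - (N - 1 - i) = i := by omega
  have hj : N - 1 - (N - 1 - j) = j := by omega
  refine ⟨N - 1 - i, N - 1 - j, ?_, fun p q => ?_, by omega⟩
  · rw [YoungDiagram.mem_rotCompl, hi, hj, hν]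
    tauto
  · rw [YoungDiagram.mem_rotCompl, YoungDiagram.mem_rotCompl, hν]
    by_cases hpq : p < N ∧ q < N
    · by_cases he : p = N - 1 - i ∧ q = N - 1 - j
      · obtain ⟨rfl, rfl⟩ := he
        rw [hi, hj]
        have : N - 1 - i < N ∧ N - 1 - j < N := by omega
        tauto
      · have : ¬ (N - 1 - p = i ∧ N - 1 - q = j) := by omega
        tauto
    · have : ¬ (p = N - 1 - i ∧ q = N - 1 - j) := by omega
      tauto

theorem ContentPath.rotCompl {N : ℕ} {μ ν : YoungDiagram} {w : List ℤ} (h : ContentPath μ w ν)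
    (hN : ν ≤ squareDiagram N) :
    ContentPath (ν.rotCompl N) (w.map Neg.neg).reverse (μ.rotCompl N) := by
  induction w generalizing μ with
  | nil => simp [contentPath_nil.1 h, contentPath_nil]
  | cons c w ih =>
    obtain ⟨κ, h₁, h₂⟩ := h
    simp only [List.map_cons, List.reverse_cons]
    exact (ih h₂).append (contentPath_singleton.2 (h₁.rotCompl (h₂.le.trans hN)))

theorem rotCompl_squareDiagram (N : ℕ) : (squareDiagram N).rotCompl N = ⊥ := by
  refine YoungDiagram.ext_mem fun p q => iff_of_false ?_ (YoungDiagram.notMem_bot _)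
  rw [YoungDiagram.mem_rotCompl, mem_squareDiagram]
  omega

/-- Two tableaux of the same shape whose outer boundary is a square are linked by elementary
dual equivalences. -/
theorem ContentPath.reflTransGen_of_square {N : ℕ} {μ : YoungDiagram} {u u' : List ℤ}
    (h : ContentPath μ u (squareDiagram N)) (h' : ContentPath μ u' (squareDiagram N)) :
    Relation.ReflTransGen ElemDual u u' := by
  have g := h.rotCompl le_rfl
  have g' := h'.rotCompl le_rfl
  rw [rotCompl_squareDiagram] at g g'
  have := (g.reflTransGen_of_bot g').lift (fun w => (w.map Neg.neg).reverse)
    fun _ _ h => h.reverse_neg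
  simpa [List.map_reverse, Function.onFun] using this

theorem ContentPath.wordShuffle_snd_eq {N : ℕ} {κ μ : YoungDiagram} {u u' v : List ℤ}
    (hv : ContentPath κ v μ) (h : ContentPath μ u (squareDiagram N))
    (h' : ContentPath μ u' (squareDiagram N)) :
    (_root_.wordShuffle v u).2 = (_root_.wordShuffle v u').2 := by
  induction h.reflTransGen_of_square h' with
  | refl => rfl
  | tail h₁ h₂ ih =>
    have := h.reflTransGen_elemDual h₁
    exact (ih this).trans (h₂.wordShuffle_left hv this)

/-- Dual equivalence tested by outward slides implies dual equivalence tested by inward slides. -/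
theorem ContentPath.wordShuffle_snd_eq_of_forall {κ μ ν : YoungDiagram} {u u' v : List ℤ}
    (hv : ContentPath κ v μ) (h : ContentPath μ u ν) (h' : ContentPath μ u' ν)
    (hdual : ∀ π b, ContentPath ν b π →
      (_root_.wordShuffle u b).1 = (_root_.wordShuffle u' b).1) :
    (_root_.wordShuffle v u).2 = (_root_.wordShuffle v u').2 := by
  obtain ⟨N, hN⟩ := exists_le_squareDiagram ν
  obtain ⟨b, hb⟩ := exists_contentPath hN
  have hd := hdual _ b hb
  obtain ⟨ρ, h₁, h₂⟩ := h.wordShuffle hb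
  obtain ⟨ρ', h₁', h₂'⟩ := h'.wordShuffle hb
  rw [← hd] at h₁'
  obtain rfl := h₁.right_unique h₁'
  have key := (hv.append h₁).wordShuffle_snd_eq h₂ h₂'
  rw [wordShuffle_append_left, wordShuffle_append_left, wordShuffle_wordShuffle, hd,
    wordShuffle_wordShuffle] at key
  exact List.append_cancel_right key

/-- The contents of the first `n` boxes added along a chain. -/
def chainWord : (ℕ → YoungDiagram) → ℕ → List ℤ
  | _, 0 => []
  | T, n + 1 => contentDiff (T 0) (T 1) :: chainWord (fun t => T (t + 1)) n

@[simp] theorem length_chainWord (T : ℕ → YoungDiagram) (n : ℕ) :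
    (chainWord T n).length = n := by
  induction n generalizing T with
  | zero => rfl
  | succ n ih => simp [chainWord, ih]

theorem contentPath_chainWord {T : ℕ → YoungDiagram} {n : ℕ}
    (h : ∀ t < n, AddBox (T t) (T (t + 1))) : ContentPath (T 0) (chainWord T n) (T n) := by
  induction n generalizing T with
  | zero => rfl
  | succ n ih =>
    exact ⟨T 1, (h 0 (by omega)).addContent_s13,
      ih (T := fun t => T (t + 1)) fun t ht => h (t + 1) (by omega)⟩

theorem chainWord_congr {T T' : ℕ → YoungDiagram} {n : ℕ} (h : ∀ t ≤ n, T t = T' t) :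
    chainWord T n = chainWord T' n := by
  induction n generalizing T T' with
  | zero => rfl
  | succ n ih =>
    rw [chainWord, chainWord, h 0 (by omega), h 1 (by omega),
      ih (T := fun t => T (t + 1)) fun t ht => h (t + 1) (by omega)]

theorem eq_of_chainWord_eq {T T' : ℕ → YoungDiagram} {n : ℕ}
    (h : ∀ t < n, AddBox (T t) (T (t + 1))) (h' : ∀ t < n, AddBox (T' t) (T' (t + 1)))
    (h0 : T 0 = T' 0) (hw : chainWord T n = chainWord T' n) : ∀ t ≤ n, T t = T' t := by
  induction n generalizing T T' with
  | zero =>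
    intro t ht
    obtain rfl : t = 0 := by omega
    exact h0
  | succ n ih =>
    rw [chainWord, chainWord, List.cons.injEq] at hw
    have h₁ := (h 0 (by omega)).addContent_s13
    have h₁' := (h' 0 (by omega)).addContent_s13
    simp only [zero_add] at h₁ h₁'
    rw [hw.1, h0] at h₁
    intro t ht
    cases t with
    | zero => exact h0
    | succ t =>
      exact ih (T := fun t => T (t + 1)) (T' := fun t => T' (t + 1))
        (fun t ht => h (t + 1) (by omega)) (fun t ht => h' (t + 1) (by omega))
        (h₁.right_unique h₁') hw.2 t (by omega)

theorem ContentPath.exists_chain {μ ν : YoungDiagram} {w : List ℤ} (h : ContentPath μ w ν) :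
    ∃ T : ℕ → YoungDiagram, T 0 = μ ∧ T w.length = ν ∧
      (∀ t < w.length, AddBox (T t) (T (t + 1))) ∧ chainWord T w.length = w := by
  induction w generalizing μ with
  | nil => exact ⟨fun _ => μ, rfl, h, by simp, rfl⟩
  | cons c w ih =>
    obtain ⟨κ, h₁, h₂⟩ := h
    obtain ⟨T, rfl, hn, hT, hw⟩ := ih h₂
    refine ⟨fun t => t.casesOn μ T, rfl, hn, fun t ht => ?_, ?_⟩
    · cases t with
      | zero => exact h₁.addBox
      | succ t => exact hT t (by simpa using ht)
    · change contentDiff μ (T 0) :: chainWord T w.length = c :: w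
      rw [hw, h₁.contentDiff_eq]

theorem IsSYTChain.contentPath {μ ν : YoungDiagram} {T : ℕ → YoungDiagram}
    (h : IsSYTChain μ ν T) : ContentPath μ (chainWord T (ν.card - μ.card)) ν := by
  have := contentPath_chainWord h.2.2.2
  rwa [h.2.1, h.2.2.1] at this

theorem IsSYTChain.card_le {μ ν : YoungDiagram} {T : ℕ → YoungDiagram}
    (h : IsSYTChain μ ν T) : μ.card ≤ ν.card :=
  Finset.card_le_card (YoungDiagram.cells_subset_iff.2 h.1)

theorem ContentPath.exists_isSYTChain {μ ν : YoungDiagram} {w : List ℤ}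
    (h : ContentPath μ w ν) :
    ∃ T, IsSYTChain μ ν T ∧ chainWord T (ν.card - μ.card) = w := by
  obtain ⟨T, h0, hn, hT, hw⟩ := h.exists_chain
  have : ν.card - μ.card = w.length := by have := h.card_eq; omega
  exact ⟨T, ⟨h.le, h0, this ▸ hn, this ▸ hT⟩, this ▸ hw⟩

theorem IsSYTChain.eq_of_chainWord_eq {μ ν ν' : YoungDiagram} {T T' : ℕ → YoungDiagram}
    (h : IsSYTChain μ ν T) (h' : IsSYTChain μ ν' T') (hν : ν.card = ν'.card)
    (hw : chainWord T (ν.card - μ.card) = chainWord T' (ν.card - μ.card)) :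
    ∀ t ≤ ν.card - μ.card, T t = T' t :=
  _root_.eq_of_chainWord_eq h.2.2.2 (hν ▸ h'.2.2.2) (h.2.1.trans h'.2.1.symm) hw

/-- Growth diagrams on a rectangle with `k` upward and `n` rightward steps. -/
structure IsGrowthGrid (k n : ℕ) (γ : ℕ → ℕ → YoungDiagram) : Prop where
  right : ∀ s ≤ k, ∀ t < n, AddBox (γ s t) (γ s (t + 1))
  up : ∀ s < k, ∀ t ≤ n, AddBox (γ s t) (γ (s + 1) t)
  localRule : ∀ s < k, ∀ t < n,
    LocalRule (γ s t) (γ s (t + 1)) (γ (s + 1) t) (γ (s + 1) (t + 1))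

theorem IsGrowthGrid.slideLetter {n : ℕ} {γ : ℕ → ℕ → YoungDiagram} (h : IsGrowthGrid 1 n γ) :
    slideLetter (chainWord (γ 0) n) (contentDiff (γ 0 n) (γ 1 n)) =
      (contentDiff (γ 0 0) (γ 1 0), chainWord (γ 1) n) := by
  induction n generalizing γ with
  | zero => rfl
  | succ n ih =>
    have ih := ih (γ := fun s t => γ s (t + 1))
      ⟨fun s hs t ht => h.right s hs (t + 1) (by omega),
        fun s hs t ht => h.up s hs (t + 1) (by omega),
        fun s hs t ht => h.localRule s hs (t + 1) (by omega)⟩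
    have hswap := AddContent.eq_contentSwap (h.right 0 (by omega) 0 (by omega)).addContent_s13
      (h.up 0 (by omega) 1 (by omega)).addContent_s13 (h.up 0 (by omega) 0 (by omega)).addContent_s13
      (h.right 1 (by omega) 0 (by omega)).addContent_s13 (h.localRule 0 (by omega) 0 (by omega))
    simp only [zero_add] at hswap ih
    simp only [chainWord, _root_.slideLetter, ih, hswap]

theorem IsGrowthGrid.wordShuffle {k n : ℕ} {γ : ℕ → ℕ → YoungDiagram} (h : IsGrowthGrid k n γ) :
    wordShuffle (chainWord (γ 0) n) (chainWord (fun s => γ s n) k) =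
      (chainWord (fun s => γ s 0) k, chainWord (γ k) n) := by
  induction k generalizing γ with
  | zero => simp [chainWord]
  | succ k ih =>
    have ih := ih (γ := fun s => γ (s + 1))
      ⟨fun s hs => h.right (s + 1) (by omega), fun s hs => h.up (s + 1) (by omega),
        fun s hs => h.localRule (s + 1) (by omega)⟩
    have hslide := IsGrowthGrid.slideLetter (n := n) (γ := γ)
      ⟨fun s hs => h.right s (by omega), fun s hs => h.up s (by omega),
        fun s hs => h.localRule s (by omega)⟩
    simp only [zero_add] at ih
    simp only [chainWord, _root_.wordShuffle, hslide, ih]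

theorem exists_growth_row {n : ℕ} {T : ℕ → YoungDiagram} {κ : YoungDiagram}
    (hT : ∀ t < n, AddBox (T t) (T (t + 1))) (hκ : AddBox (T n) κ) :
    ∃ T' : ℕ → YoungDiagram, T' n = κ ∧ (∀ t < n, AddBox (T' t) (T' (t + 1))) ∧
      (∀ t ≤ n, AddBox (T t) (T' t)) ∧
      ∀ t < n, LocalRule (T t) (T (t + 1)) (T' t) (T' (t + 1)) := by
  induction n generalizing T with
  | zero =>
    refine ⟨fun _ => κ, rfl, by simp, fun t ht => ?_, by simp⟩
    obtain rfl : t = 0 := by omega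
    exact hκ
  | succ n ih =>
    obtain ⟨T', hn, h₁, h₂, h₃⟩ := ih (T := fun t => T (t + 1))
      (fun t ht => hT (t + 1) (by omega)) hκ
    obtain ⟨ρ, g₁, g₂, g₃⟩ := AddBox.exists_localRule (hT 0 (by omega)) (h₂ 0 (by omega))
    refine ⟨fun t => t.casesOn ρ T', hn, ?_, ?_, ?_⟩
    · rintro (_ | t) ht
      · exact g₂
      · exact h₁ t (by omega)
    · rintro (_ | t) ht
      · exact g₁
      · exact h₂ t (by omega)
    · rintro (_ | t) ht
      · exact g₃
      · exact h₃ t (by omega)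

theorem exists_isGrowthGrid {k n : ℕ} {δ ε : ℕ → YoungDiagram}
    (hδ : ∀ t < n, AddBox (δ t) (δ (t + 1))) (hε : ∀ s < k, AddBox (ε s) (ε (s + 1)))
    (h : δ n = ε 0) :
    ∃ γ, IsGrowthGrid k n γ ∧ γ 0 = δ ∧ ∀ s ≤ k, γ s n = ε s := by
  induction k generalizing δ ε with
  | zero =>
    refine ⟨fun _ => δ, ⟨fun _ _ => hδ, by simp, by simp⟩, rfl, fun s hs => ?_⟩
    obtain rfl : s = 0 := by omega
    exact h
  | succ k ih =>
    obtain ⟨δ', hn, h₁, h₂, h₃⟩ := exists_growth_row hδ (h ▸ hε 0 (by omega))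
    obtain ⟨γ, hγ, rfl, hγε⟩ := ih h₁ (ε := fun s => ε (s + 1))
      (fun s hs => hε (s + 1) (by omega)) hn
    refine ⟨fun s => s.casesOn δ γ, ⟨?_, ?_, ?_⟩, rfl, ?_⟩
    · rintro (_ | s) hs
      · exact hδ
      · exact hγ.right s (by omega)
    · rintro (_ | s) hs
      · exact h₂
      · exact hγ.up s (by omega)
    · rintro (_ | s) hs
      · exact h₃
      · exact hγ.localRule s (by omega)
    · rintro (_ | s) hs
      · exact h
      · exact hγε s (by omega)

theorem IsShuffle.exists_isGrowthGrid {m q p : ℕ} {δ ε ε' δ' : ℕ → YoungDiagram} (hmq : m ≤ q)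
    (h : IsShuffle m q p δ ε ε' δ') :
    ∃ γ, IsGrowthGrid (p - q) (q - m) γ ∧ (∀ t ≤ q - m, γ 0 t = δ t) ∧
      (∀ s ≤ p - q, γ s (q - m) = ε s) ∧ (∀ s ≤ p - q, γ s 0 = ε' s) ∧
      ∀ t ≤ q - m, γ (p - q) t = δ' t := by
  obtain ⟨g, h₁, h₂, h₃, h₄⟩ := h
  have hs : ∀ s : ℕ, (-((s + 1 : ℕ) : ℤ)) = -(s : ℤ) - 1 := by intro s; push_cast; ring
  have ht : ∀ t : ℕ, (m : ℤ) + ((t + 1 : ℕ) : ℤ) = m + t + 1 := by intro t; push_cast; ring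
  refine ⟨fun s t => g.γ (-(s : ℤ)) (m + t), ⟨?_, ?_, ?_⟩, by simpa using h₁, ?_, by simpa using h₃,
    h₄⟩
  · intro s hs' t ht'
    simp only [ht]
    exact g.grow_right _ _ (by omega) (by omega) (by omega) (by omega)
  · intro s hs' t ht'
    simp only [hs]
    exact g.grow_up _ _ (by omega) (by omega) (by omega) (by omega)
  · intro s hs' t ht'
    simp only [hs, ht]
    exact g.nonadj _ _ (by omega) (by omega) (by omega) (by omega)
  · intro s hs'
    have hq : (m : ℤ) + (q - m : ℕ) = q := by omega
    simpa only [hq] using h₂ s hs'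

theorem IsGrowthGrid.isShuffle {m q p : ℕ} {γ : ℕ → ℕ → YoungDiagram} (hmq : m ≤ q)
    (h : IsGrowthGrid (p - q) (q - m) γ) {δ ε : ℕ → YoungDiagram}
    (hδ : ∀ t ≤ q - m, γ 0 t = δ t) (hε : ∀ s ≤ p - q, γ s (q - m) = ε s) :
    IsShuffle m q p δ ε (fun s => γ s 0) (γ (p - q)) := by
  classical
  let f : ℤ → ℤ → YoungDiagram := fun i j =>
    if -((p - q : ℕ) : ℤ) ≤ i ∧ i ≤ 0 ∧ (m : ℤ) ≤ j ∧ j ≤ q then γ (-i).toNat (j - m).toNat else ⊥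
  have hf : ∀ (i j : ℤ) (s t : ℕ), i = -(s : ℤ) → j = m + t → s ≤ p - q → t ≤ q - m →
      f i j = γ s t := by
    rintro _ _ s t rfl rfl hs ht
    simp only [f]
    rw [if_pos (by omega)]
    congr 1 <;> omega
  have hcoord : ∀ i j : ℤ, -((p - q : ℕ) : ℤ) ≤ i → i ≤ 0 → (m : ℤ) ≤ j →
      ∃ s t : ℕ, i = -(s : ℤ) ∧ j = m + t := fun i j h1 h2 h3 =>
    ⟨(-i).toNat, (j - m).toNat, by omega, by omega⟩
  refine ⟨⟨f, fun i j hij => if_neg hij, ?_, ?_, ?_⟩, ?_, ?_, ?_, ?_⟩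
  · intro i j h1 h2 h3 h4
    obtain ⟨s, t, rfl, rfl⟩ := hcoord i j h1 h2 h3
    rw [hf _ _ s t rfl rfl (by omega) (by omega),
      hf _ _ s (t + 1) rfl (by push_cast; ring) (by omega) (by omega)]
    exact h.right s (by omega) t (by omega)
  · intro i j h1 h2 h3 h4
    obtain ⟨s, t, rfl, rfl⟩ := hcoord i j (by omega) h2 h3
    rw [hf _ _ s t rfl rfl (by omega) (by omega),
      hf _ _ (s + 1) t (by push_cast; ring) rfl (by omega) (by omega)]
    exact h.up s (by omega) t (by omega)
  · intro i j h1 h2 h3 h4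
    obtain ⟨s, t, rfl, rfl⟩ := hcoord i j (by omega) h2 h3
    rw [hf _ _ s t rfl rfl (by omega) (by omega),
      hf _ _ (s + 1) (t + 1) (by push_cast; ring) (by push_cast; ring) (by omega) (by omega),
      hf _ _ s (t + 1) rfl (by push_cast; ring) (by omega) (by omega),
      hf _ _ (s + 1) t (by push_cast; ring) rfl (by omega) (by omega)]
    exact h.localRule s (by omega) t (by omega)
  · intro t ht
    rw [← hδ t ht]
    exact hf _ _ 0 t (by simp) rfl (by omega) ht
  · intro s hs
    rw [← hε s hs]
    exact hf _ _ s (q - m) rfl (by omega) hs le_rfl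
  · intro s hs
    exact hf _ _ s 0 rfl (by simp) hs (by omega)
  · intro t ht
    exact hf _ _ (p - q) t rfl rfl le_rfl ht

/-- Shuffling standard tableaux corresponds to shuffling their content words. -/
theorem IsShuffle.wordShuffle {m q p : ℕ} {δ ε ε' δ' : ℕ → YoungDiagram} (hmq : m ≤ q)
    (h : IsShuffle m q p δ ε ε' δ') :
    wordShuffle (chainWord δ (q - m)) (chainWord ε (p - q)) =
      (chainWord ε' (p - q), chainWord δ' (q - m)) := by
  obtain ⟨γ, hγ, h₁, h₂, h₃, h₄⟩ := h.exists_isGrowthGrid hmq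
  rw [← chainWord_congr h₁, ← chainWord_congr h₂, ← chainWord_congr h₃, ← chainWord_congr h₄]
  exact hγ.wordShuffle

theorem IsShuffle.isSYTChain {μ ν π : YoungDiagram} {δ ε ε' δ' : ℕ → YoungDiagram}
    (hδ : IsSYTChain μ ν δ) (hε : IsSYTChain ν π ε)
    (h : IsShuffle μ.card ν.card π.card δ ε ε' δ') :
    ∃ ν', IsSYTChain μ ν' ε' ∧ IsSYTChain ν' π δ' ∧
      ν'.card - μ.card = π.card - ν.card ∧ π.card - ν'.card = ν.card - μ.card := by
  obtain ⟨γ, hγ, h₁, h₂, h₃, h₄⟩ := h.exists_isGrowthGrid hδ.card_le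
  set k := π.card - ν.card with hk
  set n := ν.card - μ.card with hn
  have hε' : ∀ s < k, AddBox (ε' s) (ε' (s + 1)) := fun s hs => by
    rw [← h₃ s hs.le, ← h₃ (s + 1) hs]
    exact hγ.up s hs 0 (by omega)
  have hδ' : ∀ t < n, AddBox (δ' t) (δ' (t + 1)) := fun t ht => by
    rw [← h₄ t ht.le, ← h₄ (t + 1) ht]
    exact hγ.right k le_rfl t ht
  have e0 : ε' 0 = μ := by rw [← h₃ 0 (by omega), h₁ 0 (by omega), hδ.2.1]
  have ed : δ' 0 = ε' k := by rw [← h₄ 0 (by omega), h₃ k le_rfl]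
  have dn : δ' n = π := by rw [← h₄ n le_rfl, h₂ k le_rfl, hε.2.2.1]
  have c₁ := contentPath_chainWord hε'
  have c₂ := contentPath_chainWord hδ'
  rw [e0] at c₁
  rw [ed, dn] at c₂
  have d₁ := c₁.card_eq
  have d₂ := c₂.card_eq
  rw [length_chainWord] at d₁ d₂
  have b₁ : (ε' k).card - μ.card = k := by omega
  have b₂ : π.card - (ε' k).card = n := by omega
  exact ⟨ε' k, ⟨c₁.le, e0, by rw [b₁], by rwa [b₁]⟩, ⟨c₂.le, ed, by rwa [b₂], by rwa [b₂]⟩, b₁, b₂⟩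

theorem IsSYTChain.exists_isShuffle {μ ν π : YoungDiagram} {δ ε : ℕ → YoungDiagram}
    (hδ : IsSYTChain μ ν δ) (hε : IsSYTChain ν π ε) :
    ∃ ε' δ', IsShuffle μ.card ν.card π.card δ ε ε' δ' := by
  obtain ⟨γ, hγ, h₁, h₂⟩ := exists_isGrowthGrid hδ.2.2.2 hε.2.2.2 (hδ.2.2.1.trans hε.2.1.symm)
  exact ⟨_, _, hγ.isShuffle hδ.card_le (fun t _ => by rw [h₁]) h₂⟩

/-- The content word of the rectification of a skew tableau. -/
noncomputable def rectWord (x : SkewTab) : List ℤ :=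
  (wordShuffle (exists_contentPath (bot_le : ⊥ ≤ x.1)).choose
    (chainWord x.2.2 (x.2.1.card - x.1.card))).1

theorem IsSYTChain.rectWord_eq {μ ν : YoungDiagram} {T : ℕ → YoungDiagram} {α : List ℤ}
    (h : IsSYTChain μ ν T) (hα : ContentPath ⊥ α μ) :
    rectWord (μ, ν, T) = (wordShuffle α (chainWord T (ν.card - μ.card))).1 :=
  (exists_contentPath bot_le).choose_spec.wordShuffle_fst_eq hα h.contentPath

theorem IsSYTChain.rectWord_bot {μ : YoungDiagram} {T : ℕ → YoungDiagram}
    (h : IsSYTChain ⊥ μ T) : rectWord (⊥, μ, T) = chainWord T (μ.card - (⊥ : YoungDiagram).card) := by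
  rw [h.rectWord_eq (contentPath_nil.2 rfl), wordShuffle_nil_left]

theorem ShuffleMove.rectWord_eq {x y : SkewTab} (h : ShuffleMove x y) :
    rectWord x = rectWord y := by
  obtain ⟨μ, ν, π, ν', δ, ε, ε', δ', hδ, hε, hsh, hε', hδ', h⟩ := h
  obtain ⟨κ, -, hκ, h₁, h₂⟩ := hsh.isSYTChain hδ hε
  obtain rfl : ν' = κ := hδ'.2.1.symm.trans hκ.2.1
  have hword := hsh.wordShuffle hδ.card_le
  have hinv := wordShuffle_wordShuffle (chainWord δ (ν.card - μ.card))
    (chainWord ε (π.card - ν.card))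
  obtain ⟨α, hα⟩ := exists_contentPath (bot_le : ⊥ ≤ μ)
  rcases h with ⟨rfl, rfl⟩ | ⟨rfl, rfl⟩
  · rw [hδ.rectWord_eq hα, hδ'.rectWord_eq (hα.append hε'.contentPath), wordShuffle_append_left,
      h₁, h₂]
    rw [hword] at hinv
    simp only [hinv]
  · rw [hε.rectWord_eq (hα.append hδ.contentPath), hε'.rectWord_eq hα, wordShuffle_append_left,
      h₁, hword]

theorem SlideEquiv.rectWord_eq {x y : SkewTab} (h : SlideEquiv x y) : rectWord x = rectWord y := by
  induction h with
  | rel _ _ h => exact h.rectWord_eq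
  | refl => rfl
  | symm _ _ _ ih => exact ih.symm
  | trans _ _ _ _ _ ih ih' => exact ih.trans ih'

/-- Tableaux with the same recording of their inward slides are dual equivalent. -/
theorem ContentPath.wordShuffle_fst_eq_of_snd_eq {ν₁ ν₂ π : YoungDiagram} {α f w b : List ℤ}
    (hα : ContentPath ⊥ α ν₁) (hf : ContentPath ν₁ f ν₂) (hw : ContentPath ν₁ w ν₂)
    (hb : ContentPath ν₂ b π) (h : (_root_.wordShuffle α f).2 = (_root_.wordShuffle α w).2) :
    (_root_.wordShuffle f b).1 = (_root_.wordShuffle w b).1 := by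
  obtain ⟨κ, h₁, h₂⟩ := hα.wordShuffle hf
  obtain ⟨κ', h₁', h₂'⟩ := hα.wordShuffle hw
  rw [← h] at h₂'
  obtain rfl := h₂.left_unique h₂'
  have key := h₁.wordShuffle_fst_eq h₁' (h₂.append hb)
  rw [wordShuffle_append_right, wordShuffle_append_right, wordShuffle_wordShuffle, h,
    wordShuffle_wordShuffle] at key
  exact List.append_cancel_left key

theorem dualEquiv_of_forall {ν₁ ν₂ : YoungDiagram} {φ δ : ℕ → YoungDiagram}
    (hφ : IsSYTChain ν₁ ν₂ φ) (hδ : IsSYTChain ν₁ ν₂ δ)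
    (h : ∀ π b, ContentPath ν₂ b π →
      (wordShuffle (chainWord φ (ν₂.card - ν₁.card)) b).1 =
        (wordShuffle (chainWord δ (ν₂.card - ν₁.card)) b).1) : DualEquiv ν₁ ν₂ φ δ := by
  refine ⟨hφ, hδ, fun π ε ε₁' δ₁' ε₂' δ₂' hε h₁ h₂ => ?_⟩
  obtain ⟨κ, hκ, -, e₁, -⟩ := h₁.isSYTChain hφ hε
  obtain ⟨κ', hκ', -, e₂, -⟩ := h₂.isSYTChain hδ hε
  have hword := h π _ hε.contentPath
  rw [h₁.wordShuffle hφ.card_le, h₂.wordShuffle hδ.card_le, ← e₁] at hword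
  rw [← e₁]
  exact hκ.eq_of_chainWord_eq hκ' (by have := hκ.card_le; have := hκ'.card_le; omega) hword

theorem DualEquiv.wordShuffle_fst_eq {ν₁ ν₂ π : YoungDiagram} {φ δ : ℕ → YoungDiagram}
    {b : List ℤ} (h : DualEquiv ν₁ ν₂ φ δ) (hb : ContentPath ν₂ b π) :
    (wordShuffle (chainWord φ (ν₂.card - ν₁.card)) b).1 =
      (wordShuffle (chainWord δ (ν₂.card - ν₁.card)) b).1 := by
  obtain ⟨hφ, hδ, h⟩ := h
  obtain ⟨B, hB, rfl⟩ := hb.exists_isSYTChain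
  obtain ⟨ε₁', δ₁', h₁⟩ := hφ.exists_isShuffle hB
  obtain ⟨ε₂', δ₂', h₂⟩ := hδ.exists_isShuffle hB
  rw [h₁.wordShuffle hφ.card_le, h₂.wordShuffle hδ.card_le]
  exact chainWord_congr (h π B ε₁' δ₁' ε₂' δ₂' hB h₁ h₂)

/-- **Unique tableau in a given slide class and a given dual class.** Let `μ` be a
Young diagram, `ε` a standard tableau of shape `μ/∅` and `δ` a standard tableau
(of shape `ν₂/ν₁`) which is slide equivalent to some standard tableau `σ` of shape
`μ/∅`. Then there is exactly one standard tableau `φ` which is slide equivalent to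
`ε` and dual equivalent to `δ` (uniqueness as a chain, i.e. up to the values
`φ t` for `t ≤ |ν₂| − |ν₁|`). -/
theorem stmt13 (μ : YoungDiagram) (ε : ℕ → YoungDiagram) (hε : IsSYTChain ⊥ μ ε)
    (ν₁ ν₂ : YoungDiagram) (δ : ℕ → YoungDiagram) (hδ : IsSYTChain ν₁ ν₂ δ)
    (σ : ℕ → YoungDiagram) (hσ : IsSYTChain ⊥ μ σ)
    (hrect : SlideEquiv (ν₁, ν₂, δ) (⊥, μ, σ)) :
    ∃ φ : ℕ → YoungDiagram,
      (IsSYTChain ν₁ ν₂ φ ∧ SlideEquiv (ν₁, ν₂, φ) (⊥, μ, ε) ∧ DualEquiv ν₁ ν₂ φ δ) ∧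
      ∀ φ' : ℕ → YoungDiagram,
        IsSYTChain ν₁ ν₂ φ' → SlideEquiv (ν₁, ν₂, φ') (⊥, μ, ε) → DualEquiv ν₁ ν₂ φ' δ →
        ∀ t : ℕ, t ≤ ν₂.card - ν₁.card → φ' t = φ t := by
  obtain ⟨α, hα⟩ := exists_contentPath (bot_le : ⊥ ≤ ν₁)
  have hrect' := hrect.rectWord_eq
  rw [hδ.rectWord_eq hα, hσ.rectWord_bot] at hrect'
  obtain ⟨μ', hr, hα'⟩ := hα.wordShuffle hδ.contentPath
  have hr' := hσ.contentPath
  rw [← hrect'] at hr'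
  obtain rfl := hr'.right_unique hr
  obtain ⟨A, hA, hAw⟩ := hα'.exists_isSYTChain
  obtain ⟨ε', φ, hsh⟩ := hε.exists_isShuffle hA
  obtain ⟨ν', hε', hφ, e₁, e₂⟩ := hsh.isSYTChain hε hA
  have hword := hsh.wordShuffle hε.card_le
  have hfst := hε.contentPath.wordShuffle_fst_eq hr hα'
  rw [wordShuffle_wordShuffle, ← hAw, hword, ← e₁] at hfst
  replace hfst : chainWord ε' (ν'.card - (⊥ : YoungDiagram).card) = α := hfst
  have hε'w := hε'.contentPath
  rw [hfst] at hε'w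
  obtain rfl := hα.right_unique hε'w
  have hφw : wordShuffle α (chainWord φ (ν₂.card - ν₁.card)) =
      (chainWord ε (μ.card - (⊥ : YoungDiagram).card),
        (wordShuffle α (chainWord δ (ν₂.card - ν₁.card))).2) := by
    have hinv := wordShuffle_wordShuffle (chainWord ε (μ.card - (⊥ : YoungDiagram).card))
      (wordShuffle α (chainWord δ (ν₂.card - ν₁.card))).2
    rw [← hAw, hword] at hinv
    rw [← hAw, e₂, ← hfst, e₁]
    exact hinv
  refine ⟨φ, ⟨hφ, ?_, ?_⟩, fun φ' hφ' hslide hdual => ?_⟩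
  · exact .symm _ _ (.rel _ _ ⟨⊥, μ, ν₂, ν₁, ε, A, ε', φ, hε, hA, hsh, hε', hφ, .inl ⟨rfl, rfl⟩⟩)
  · refine dualEquiv_of_forall hφ hδ fun π b hb => ?_
    exact hα.wordShuffle_fst_eq_of_snd_eq hφ.contentPath hδ.contentPath hb (by rw [hφw])
  · have h₁ := hslide.rectWord_eq
    rw [hφ'.rectWord_eq hα, hε.rectWord_bot] at h₁
    have h₂ := hα.wordShuffle_snd_eq_of_forall hφ'.contentPath hδ.contentPath
      fun π b hb => hdual.wordShuffle_fst_eq hb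
    have h₃ : wordShuffle α (chainWord φ' (ν₂.card - ν₁.card)) =
        wordShuffle α (chainWord φ (ν₂.card - ν₁.card)) :=
      Prod.ext (by rw [h₁, hφw]) (by rw [h₂, hφw])
    have h₄ := wordShuffle_wordShuffle α (chainWord φ' (ν₂.card - ν₁.card))
    rw [h₃, wordShuffle_wordShuffle] at h₄
    exact hφ'.eq_of_chainWord_eq hφ rfl (Prod.ext_iff.1 h₄).2.symm
end

section
/- Let m ≥ 2 be an integer, let τ be a nonzero complex number, and let A, B, C, D be nonzero complex numbers with m²·B·C = (m²−1)·A·D. (a) If (p_L, p_{K1}, p_{K2}, p_M) ∈ ℂ⁴ satisfies A·p_L = τ, D·p_M = 1, B·p_{K1} + C·p_{K2} = 1 + τ, and p_L·p_M = p_{K1}·p_{K2}, then p_{K1} ≠ 0, the number u := (m/(m−1))·B·p_{K1} satisfies (m−1)·u² − m·(1+τ)·u + (m+1)·τ = 0, and C·p_{K2} = ((m+1)/m)·(τ/u). (b) Conversely, if u ∈ ℂ satisfies (m−1)·u² − m·(1+τ)·u + (m+1)·τ = 0, then u ≠ 0 and the tuple p_L = τ/A, p_{K1} = ((m−1)/m)·(u/B),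 p_{K2} = ((m+1)/m)·(τ/(u·C)), p_M = 1/D satisfies A·p_L = τ, D·p_M = 1, B·p_{K1} + C·p_{K2} = 1 + τ, and p_L·p_M = p_{K1}·p_{K2}. -/
/-- **Plücker coordinates of the four-point Schubert problem and the conic.**
Let `m ≥ 2`, `τ ∈ ℂ` nonzero, and `A, B, C, D` nonzero complex numbers with
`m²·B·C = (m²−1)·A·D`.
(a) If `(p_L, p_{K1}, p_{K2}, p_M)` satisfies `A·p_L = τ`, `D·p_M = 1`,
`B·p_{K1} + C·p_{K2} = 1 + τ` and `p_L·p_M = p_{K1}·p_{K2}`, then `p_{K1} ≠ 0`,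
`u := (m/(m−1))·B·p_{K1}` satisfies `(m−1)u² − m(1+τ)u + (m+1)τ = 0`, and
`C·p_{K2} = ((m+1)/m)·(τ/u)`.
(b) Conversely, every root `u` of the conic equation is nonzero and yields such a
solution via `p_L = τ/A`, `p_{K1} = ((m−1)/m)·(u/B)`, `p_{K2} = ((m+1)/m)·(τ/(u·C))`,
`p_M = 1/D`. -/
theorem stmt15 (m : ℕ) (hm : 2 ≤ m) (τ : ℂ) (hτ : τ ≠ 0)
    (A B C D : ℂ) (hA : A ≠ 0) (hB : B ≠ 0) (hC : C ≠ 0) (hD : D ≠ 0)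
    (h : (m : ℂ) ^ 2 * B * C = ((m : ℂ) ^ 2 - 1) * A * D) :
    (∀ pL pK1 pK2 pM : ℂ,
      A * pL = τ → D * pM = 1 → B * pK1 + C * pK2 = 1 + τ → pL * pM = pK1 * pK2 →
      pK1 ≠ 0 ∧
      (∀ u : ℂ, u = (m : ℂ) / ((m : ℂ) - 1) * B * pK1 →
        ((m : ℂ) - 1) * u ^ 2 - (m : ℂ) * (1 + τ) * u + ((m : ℂ) + 1) * τ = 0 ∧
        C * pK2 = (((m : ℂ) + 1) / (m : ℂ)) * (τ / u)))
    ∧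
    (∀ u : ℂ,
      ((m : ℂ) - 1) * u ^ 2 - (m : ℂ) * (1 + τ) * u + ((m : ℂ) + 1) * τ = 0 →
      u ≠ 0 ∧
      (∀ pL pK1 pK2 pM : ℂ,
        pL = τ / A → pK1 = (((m : ℂ) - 1) / (m : ℂ)) * (u / B) →
        pK2 = (((m : ℂ) + 1) / (m : ℂ)) * (τ / (u * C)) → pM = 1 / D →
        A * pL = τ ∧ D * pM = 1 ∧ B * pK1 + C * pK2 = 1 + τ ∧
          pL * pM = pK1 * pK2)) := by
  have hm0 : (m : ℂ) ≠ 0 := by exact_mod_cast (by omega : m ≠ 0)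
  have hm1 : (m : ℂ) - 1 ≠ 0 := sub_ne_zero.mpr (by exact_mod_cast (by omega : m ≠ 1))
  have hm2 : (m : ℂ) + 1 ≠ 0 := by exact_mod_cast (by omega : m + 1 ≠ 0)
  generalize (m : ℂ) = n at *
  refine ⟨fun pL pK1 pK2 pM hL hM hW hP => ?_, fun u hu => ?_⟩
  · have key : n ^ 2 * (B * pK1) * (C * pK2) = (n - 1) * (n + 1) * τ := by
      linear_combination (pK1 * pK2) * h - (n ^ 2 - 1) * A * D * hP
        + (n ^ 2 - 1) * D * pM * hL + (n ^ 2 - 1) * τ * hM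
    have hK1 : pK1 ≠ 0 := by
      rintro rfl
      exact mul_ne_zero (mul_ne_zero hm1 hm2) hτ (by simpa using key.symm)
    refine ⟨hK1, fun u hu => ?_⟩
    have hu0 : u ≠ 0 := by
      rw [hu]
      exact mul_ne_zero (mul_ne_zero (div_ne_zero hm0 hm1) hB) hK1
    have hx : (n - 1) * u = n * (B * pK1) := by
      rw [hu]
      field_simp
    have hy : n * u * (C * pK2) = (n + 1) * τ := by
      apply mul_left_cancel₀ hm1
      linear_combination key + n * (C * pK2) * hx
    refine ⟨by linear_combination u * hx + n * u * hW - hy, ?_⟩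
    rw [div_mul_div_comm, eq_div_iff (mul_ne_zero hm0 hu0)]
    linear_combination hy
  · have hu0 : u ≠ 0 := by
      rintro rfl
      exact mul_ne_zero hm2 hτ (by simpa using hu)
    refine ⟨hu0, ?_⟩
    rintro _ _ _ _ rfl rfl rfl rfl
    refine ⟨by field_simp, by field_simp, ?_, ?_⟩
    · field_simp
      linear_combination hu
    · field_simp
      linear_combination h
end
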